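/- Let 𝔞 be a finite-dimensional Lie algebra over a field F of prime characteristic and let M be a maximal two-sided ideal of U(𝔞). Then Ext^d_{U(𝔞)}(U(𝔞)/M, U(𝔞)) ≠ 0 and Ext^n_{U(𝔞)}(U(𝔞)/M, U(𝔞)) = 0 for n > d, where d = dim_F 𝔞; that is, the upper grade of every maximal ideal of U(𝔞) equals dim_F 𝔞. -/

import Mathlib

open CategoryTheory

universe u

/-- The `n`-th Ext group over the `F`-algebra `R`, as a functor value on modules. -/
noncomputable def ExtGrp (F : Type u) [Field F] (R : Type u) [Ring R] [Algebra F R]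
    (X M : ModuleCat.{u} R) (n : ℕ) : ModuleCat F :=
  ((Ext F (ModuleCat.{u} R) n).obj (Opposite.op X)).obj M

namespace UGr

/-- Vanishing of the `n`-th cohomology of `Hom(P, Y)`, expressed elementwise. -/
def CocycleTriv {C : Type*} [Category C] [Abelian C] (P : ChainComplex C ℕ) (n : ℕ) (Y : C) : Prop :=
  ∀ f : P.X n ⟶ Y, P.d (n+1) n ≫ f = 0 → ∃ g : P.X (n-1) ⟶ Y, P.d n (n-1) ≫ g = f

lemma derived_iff {F : Type u} [Field F] {C : Type*} [Category.{u} C] [Abelian C] [Linear F C]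
    [EnoughProjectives C] {X : C} (P : ProjectiveResolution X) (n : ℕ) (Y : C) :
    Subsingleton (((Ext F C n).obj (Opposite.op X)).obj Y) ↔ CocycleTriv P.complex n Y := by
  rw [← ModuleCat.isZero_iff_subsingleton, (P.isoExt n Y).isZero_iff,
    ← HomologicalComplex.exactAt_iff_isZero_homology,
    HomologicalComplex.exactAt_iff' _ (n-1) n (n+1) (by cases n <;> simp) (by simp),
    ShortComplex.moduleCat_exact_iff]
  constructor
  · intro h f hf
    obtain ⟨g, hg⟩ := h f hf
    exact ⟨g, hg⟩
  · intro h f hf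
    obtain ⟨g, hg⟩ := h f hf
    exact ⟨g, hg⟩

lemma ext_iff {C : Type*} [Category C] [Abelian C] [HasExt.{u} C]
    {X : C} (P : ProjectiveResolution X) (n : ℕ) (Y : C) :
    Subsingleton (Abelian.Ext X Y n) ↔ CocycleTriv P.complex n Y := by
  cases n with
  | zero =>
    rw [Abelian.Ext.homEquiv₀.subsingleton_congr]
    have e : ((ChainComplex.single₀ C).obj X).X 0 ≅ X :=
      HomologicalComplex.singleObjXSelf (ComplexShape.down ℕ) 0 X
    have hc := P.exact₀
    have hepi : Epi (P.π.f 0) := inferInstance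
    have h0 : P.complex.d 0 (0-1) = 0 := by
      apply P.complex.shape; simp
    constructor
    · intro h f hf
      refine ⟨0, ?_⟩
      have hk : P.π.f 0 ≫ e.hom ≫ (e.inv ≫ hc.desc f hf) = f := by
        rw [Iso.hom_inv_id_assoc]
        exact hc.g_desc f hf
      rw [Subsingleton.elim (e.inv ≫ hc.desc f hf) 0, Limits.comp_zero, Limits.comp_zero] at hk
      rw [Limits.comp_zero, hk]
    · intro h
      refine ⟨fun a b => ?_⟩
      rw [← sub_eq_zero]
      obtain ⟨g, hg⟩ := h (P.π.f 0 ≫ e.hom ≫ (a - b)) (by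
        have := P.complex_d_comp_π_f_zero
        rw [← Category.assoc, this, Limits.zero_comp])
      rw [h0, Limits.zero_comp, eq_comm, ← Category.assoc] at hg
      exact Limits.zero_of_epi_comp _ hg
  | succ n =>
    constructor
    · intro h f hf
      have := (P.extMk_eq_zero_iff f (n+2) rfl hf n rfl).1 (Subsingleton.elim _ _)
      simpa using this
    · intro h
      refine ⟨fun a b => ?_⟩
      rw [← sub_eq_zero]
      obtain ⟨f, hf, hh⟩ := P.extMk_surjective (a - b) (n+2) rfl
      rw [← hh, P.extMk_eq_zero_iff f (n+2) rfl hf n rfl]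
      simpa using h f hf


section Frob

variable {W R : Type u} [CommRing W] [Ring R] [Algebra W R]

lemma projective_restrict [Module.Free W R] (Q : Type u) [AddCommGroup Q] [Module R Q] [Module W Q]
    [IsScalarTower W R Q] [Module.Projective R Q] : Module.Projective W Q := by
  obtain ⟨s, hs⟩ := (Module.projective_def' (R := R) (P := Q)).1 inferInstance
  exact Module.Projective.of_split (s.restrictScalars W)
    ((Finsupp.linearCombination R (id : Q → Q)).restrictScalars W)
    (by ext x; exact congrArg (fun f => f x) hs)

instance restrict_preserves [Module.Free W R] :
    (ModuleCat.restrictScalars.{u} (algebraMap W R)).PreservesProjectiveObjects where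
  projective_obj {X} hX := by
    rw [← IsProjective.iff_projective] at hX ⊢
    let : Module W X := Module.compHom X (algebraMap W R)
    have : IsScalarTower W R X := ⟨fun a b x => by
      rw [Algebra.smul_def, mul_smul]; rfl⟩
    exact projective_restrict (W := W) (R := R) X

lemma frob_lift (τ : R →ₗ[W] W)
    (hτ : ∀ φ : R →ₗ[W] W, ∃! y : R, ∀ u, τ (u * y) = φ u)
    (Q : Type u) [AddCommGroup Q] [Module R Q] [Module W Q]
    [IsScalarTower W R Q] (φ : Q →ₗ[W] W) :
    ∃ f : Q →ₗ[R] R, ∀ x, τ (f x) = φ x := by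
  have h1 : ∀ x : Q, ∃ y : R, ∀ u, τ (u * y) = φ (u • x) := fun x =>
    (hτ (φ ∘ₗ ((LinearMap.toSpanSingleton R Q x).restrictScalars W))).exists
  have hu : ∀ y z : R, (∀ u, τ (u * y) = τ (u * z)) → y = z := fun y z h => by
    refine (hτ (τ ∘ₗ ((LinearMap.toSpanSingleton R R z).restrictScalars W))).unique
      (fun u => ?_) (fun u => ?_)
    · simp [h]
    · simp
  choose f hf using h1
  refine ⟨{ toFun := f, map_add' := fun x y => ?_, map_smul' := fun r x => ?_ }, fun x => ?_⟩
  · apply hu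
    intro u
    rw [mul_add, map_add, hf, hf, hf, smul_add, map_add]
  · apply hu
    intro u
    simp only [RingHom.id_apply, smul_eq_mul]
    rw [hf, ← mul_assoc, hf, mul_smul]
  · have := hf x 1
    simpa using this

lemma frob_inj (τ : R →ₗ[W] W)
    (hτ : ∀ φ : R →ₗ[W] W, ∃! y : R, ∀ u, τ (u * y) = φ u)
    (Q : Type u) [AddCommGroup Q] [Module R Q] (f g : Q →ₗ[R] R)
    (h : ∀ x, τ (f x) = τ (g x)) : f = g := by
  ext x
  refine (hτ (τ ∘ₗ ((LinearMap.toSpanSingleton R R (g x)).restrictScalars W))).unique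
      (fun u => ?_) (fun u => ?_)
  · have := h (u • x)
    simpa using this
  · simp

lemma cocycle_restrict (τ : R →ₗ[W] W)
    (hτ : ∀ φ : R →ₗ[W] W, ∃! y : R, ∀ u, τ (u * y) = φ u)
    (P : ChainComplex (ModuleCat.{u} R) ℕ) (n : ℕ) :
    CocycleTriv P n (ModuleCat.of R R) ↔
      CocycleTriv (((ModuleCat.restrictScalars.{u} (algebraMap W R)).mapHomologicalComplex _).obj P)
        n (ModuleCat.of W W) := by
  let (k : ℕ) : Module W (P.X k) := Module.compHom (P.X k) (algebraMap W R)
  have (k : ℕ) : IsScalarTower W R (P.X k) := ⟨fun a b x => by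
      rw [Algebra.smul_def, mul_smul]; rfl⟩
  constructor
  · intro h f hf
    let f0 : P.X n →ₗ[W] W := f.hom
    have hf0 : ∀ x, f0 ((P.d (n+1) n).hom x) = 0 := fun x => congrArg (fun k => k.hom x) hf
    obtain ⟨f', hf'⟩ := frob_lift τ hτ (P.X n) f0
    obtain ⟨g', hg'⟩ := h (ModuleCat.ofHom f') (by
      ext1
      refine frob_inj τ hτ _ _ _ (fun x => ?_)
      simp [hf', hf0])
    let g0 : P.X (n-1) →ₗ[W] W := τ ∘ₗ (g'.hom.restrictScalars W)
    refine ⟨ModuleCat.ofHom (X := ((((ModuleCat.restrictScalars.{u} (algebraMap W R)).mapHomologicalComplex _).obj P).X (n-1))) g0, ?_⟩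
    ext x
    have h1 : g'.hom ((P.d n (n-1)).hom x) = f' x := congrArg (fun k => k.hom x) hg'
    change τ (g'.hom ((P.d n (n-1)).hom x)) = f0 x
    exact (congrArg τ h1).trans (hf' x)
  · intro h f hf
    let f0 : P.X n →ₗ[W] W := τ ∘ₗ (f.hom.restrictScalars W)
    obtain ⟨g, hg⟩ := h (ModuleCat.ofHom (X := ((((ModuleCat.restrictScalars.{u} (algebraMap W R)).mapHomologicalComplex _).obj P).X n)) f0) (by
      ext x
      have h1 : f.hom ((P.d (n+1) n).hom x) = 0 := congrArg (fun k => k.hom x) hf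
      change τ (f.hom ((P.d (n+1) n).hom x)) = 0
      rw [h1, map_zero])
    let g0 : P.X (n-1) →ₗ[W] W := g.hom
    obtain ⟨g', hg'⟩ := frob_lift τ hτ (P.X (n-1)) g0
    refine ⟨ModuleCat.ofHom g', ?_⟩
    ext1
    refine frob_inj τ hτ _ _ _ (fun x => ?_)
    have h1 : g0 ((P.d n (n-1)).hom x) = τ (f.hom x) := congrArg (fun k => k.hom x) hg
    rw [← h1, ← hg']
    rfl

lemma ext_frob {F : Type u} [Field F] [Algebra F R] [Module.Free W R] (τ : R →ₗ[W] W)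
    (hτ : ∀ φ : R →ₗ[W] W, ∃! y : R, ∀ u, τ (u * y) = φ u)
    (N : ModuleCat.{u} R) (n : ℕ) :
    Subsingleton (((Ext F (ModuleCat.{u} R) n).obj (Opposite.op N)).obj (ModuleCat.of R R)) ↔
    Subsingleton (Abelian.Ext ((ModuleCat.restrictScalars.{u} (algebraMap W R)).obj N)
      (ModuleCat.of W W) n) := by
  have P := ProjectiveResolution.of N
  have : (ModuleCat.restrictScalars.{u} (algebraMap W R)).PreservesHomology :=
    Functor.preservesHomology_of_map_exact _ (fun S hS => by
      rw [ShortComplex.moduleCat_exact_iff] at hS ⊢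
      exact hS)
  rw [derived_iff P, cocycle_restrict τ hτ,
    ext_iff ((ModuleCat.restrictScalars.{u} (algebraMap W R)).mapProjectiveResolution P)]
  rfl

end Frob


section Reg

open RingTheory.Sequence

variable {W : Type u} [CommRing W]

lemma reg_pd (M : Type u) [AddCommGroup M] [Module W M] (rs : List W)
    (h : IsWeaklyRegular M rs) (k : ℕ) (hk : HasProjectiveDimensionLT (ModuleCat.of W M) k) :
    HasProjectiveDimensionLT (ModuleCat.of W (M ⧸ (Ideal.ofList rs • (⊤ : Submodule W M))))
      (k + rs.length) := by
  induction rs generalizing M k with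
  | nil =>
    have e : (M ⧸ (Ideal.ofList ([] : List W) • (⊤ : Submodule W M))) ≃ₗ[W] M :=
      Submodule.quotEquivOfEqBot _ (by rw [Ideal.ofList_nil, Submodule.bot_smul])
    exact hasProjectiveDimensionLT_of_iso e.symm.toModuleIso k
  | cons r rs ih =>
    rw [isWeaklyRegular_cons_iff] at h
    have hS := IsSMulRegular.smulShortComplex_shortExact (M := ModuleCat.of W M) h.1
    have h1 : HasProjectiveDimensionLT (ModuleCat.of W (QuotSMulTop r M)) (k+1) :=
      hS.hasProjectiveDimensionLT_X₃ k hk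
        (hasProjectiveDimensionLT_of_ge (ModuleCat.of W M) k (k+1) (by omega))
    have h2 := ih (QuotSMulTop r M) h.2 (k+1) h1
    have h3 := hasProjectiveDimensionLT_of_iso
      (Submodule.quotOfListConsSMulTopEquivQuotSMulTopInner M r rs).symm.toModuleIso
      (k + 1 + rs.length)
    rwa [List.length_cons, show k + (rs.length + 1) = k + 1 + rs.length by ring]

lemma ext_nontrivial_of_iso (T : ModuleCat.{u} W) {X X' : ModuleCat.{u} W} (e : X ≅ X') (k : ℕ)
    (h : Nontrivial (Abelian.Ext X' T k)) : Nontrivial (Abelian.Ext X T k) := by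
  refine Function.Injective.nontrivial (α := Abelian.Ext X' T k)
    (f := fun x => (Abelian.Ext.mk₀ e.hom).comp x (zero_add k)) ?_
  refine Function.LeftInverse.injective
    (g := fun x => (Abelian.Ext.mk₀ e.inv).comp x (zero_add k)) (fun x => ?_)
  simp

lemma reg_ext (T : ModuleCat.{u} W) (M : Type u) [AddCommGroup M] [Module W M] (rs : List W)
    (hT : ∀ r ∈ rs, ∀ t : T, r • t = 0)
    (h : IsWeaklyRegular M rs) (k : ℕ) (hk : Nontrivial (Abelian.Ext (ModuleCat.of W M) T k)) :
    Nontrivial (Abelian.Ext (ModuleCat.of W (M ⧸ (Ideal.ofList rs • (⊤ : Submodule W M)))) T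
      (k + rs.length)) := by
  induction rs generalizing M k with
  | nil =>
    have e : (M ⧸ (Ideal.ofList ([] : List W) • (⊤ : Submodule W M))) ≃ₗ[W] M :=
      Submodule.quotEquivOfEqBot _ (by rw [Ideal.ofList_nil, Submodule.bot_smul])
    exact ext_nontrivial_of_iso T e.toModuleIso k hk
  | cons r rs ih =>
    rw [isWeaklyRegular_cons_iff] at h
    have hS := IsSMulRegular.smulShortComplex_shortExact (M := ModuleCat.of W M) h.1
    have h1 : Nontrivial (Abelian.Ext (ModuleCat.of W (QuotSMulTop r M)) T (k+1)) := by
      obtain ⟨x, hx⟩ := exists_ne (0 : Abelian.Ext (ModuleCat.of W M) T k)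
      refine ⟨⟨hS.extClass.comp (x : Abelian.Ext (ModuleCat.of W M) T k) (add_comm 1 k), 0,
        fun hx0 => hx ?_⟩⟩
      obtain ⟨y, hy⟩ : ∃ y : Abelian.Ext (ModuleCat.of W M) T k,
          (Abelian.Ext.mk₀ (r • 𝟙 (ModuleCat.of W M))).comp y (zero_add k) = x :=
        Abelian.Ext.contravariant_sequence_exact₁ hS T x (add_comm 1 k) hx0
      rw [Abelian.Ext.mk₀_smul, Abelian.Ext.smul_comp, Abelian.Ext.mk₀_id_comp] at hy
      rw [← hy]
      have : (r • 𝟙 T) = 0 := by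
        ext t
        exact hT r (by simp) t
      have h2 := Abelian.Ext.smul_eq_comp_mk₀ y r
      rw [this] at h2
      rw [h2]; simp
    have h2 := ih (QuotSMulTop r M) (fun r hr => hT r (by simp [hr])) h.2 (k+1) h1
    rw [List.length_cons, show k + (rs.length + 1) = k + 1 + rs.length by ring]
    exact ext_nontrivial_of_iso T
      (Submodule.quotOfListConsSMulTopEquivQuotSMulTopInner M r rs).toModuleIso _ h2

end Reg


section Poly

open RingTheory.Sequence

variable {F : Type u} [Field F] {d : ℕ}

/-- the list of the variables -/
noncomputable def vars (F : Type u) [Field F] (d : ℕ) : List (MvPolynomial (Fin d) F) :=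
  List.ofFn (fun i => MvPolynomial.X i)

lemma vars_take (k : ℕ) : Ideal.ofList ((vars F d).take k) =
    Ideal.span (MvPolynomial.X '' {i : Fin d | (i : ℕ) < k}) := by
  unfold Ideal.ofList
  congr 1
  ext x
  simp only [Set.mem_ofPred_eq, Set.mem_image, vars]
  constructor
  · intro h
    obtain ⟨i, hi, rfl⟩ := List.getElem_of_mem h
    simp only [List.length_take, List.length_ofFn, lt_inf_iff] at hi
    exact ⟨⟨i, hi.2⟩, hi.1, by simp⟩
  · rintro ⟨i, hi, rfl⟩
    rw [List.mem_take_iff_getElem]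
    exact ⟨i, by simp [hi], by simp⟩

lemma vars_span : Ideal.ofList (vars F d) =
    Ideal.span (MvPolynomial.X '' (Set.univ : Set (Fin d))) := by
  have := vars_take (F := F) (d := d) d
  rw [List.take_of_length_le (by simp [vars])] at this
  rw [this]; congr; ext i; simp

lemma mem_smul_top {W : Type*} [CommRing W] {ι : Type*} (I : Ideal W) (f : ι →₀ W) :
    f ∈ I • (⊤ : Submodule W (ι →₀ W)) ↔ ∀ i, f i ∈ I := by
  have := Finsupp.submodule_smul W ι (fun _ : ι => (⊤ : Submodule W W)) I
  rw [Finsupp.submodule_top] at this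
  rw [← this]
  simp [Finsupp.mem_submodule_iff]

lemma vars_regular (ι : Type*) : IsWeaklyRegular (ι →₀ MvPolynomial (Fin d) F) (vars F d) := by
  rw [isWeaklyRegular_iff_Fin]
  intro k
  rw [isSMulRegular_quotient_iff_mem_of_smul_mem]
  intro f hf
  rw [mem_smul_top, vars_take] at hf ⊢
  intro i
  have h := hf i
  have hk : (k : ℕ) < d := by simpa [vars] using k.2
  have : (vars F d)[k] = MvPolynomial.X (⟨k, hk⟩ : Fin d) := by
    exact List.getElem_ofFn (f := fun i : Fin d => (MvPolynomial.X i : MvPolynomial (Fin d) F)) _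
  rw [this, Finsupp.smul_apply, smul_eq_mul] at h
  rw [MvPolynomial.mem_ideal_span_X_image] at h ⊢
  intro m hm
  obtain ⟨j, hj, hj2⟩ := h (Finsupp.single ⟨k, hk⟩ 1 + m) (by
    rw [MvPolynomial.mem_support_iff, MvPolynomial.coeff_X_mul]
    exact MvPolynomial.mem_support_iff.1 hm)
  refine ⟨j, hj, ?_⟩
  have : (⟨k, hk⟩ : Fin d) ≠ j := by
    rintro rfl; simp at hj
  simpa [Finsupp.single_apply, this] using hj2

lemma mem_vars {f : MvPolynomial (Fin d) F} :
    f ∈ Ideal.ofList (vars F d) ↔ MvPolynomial.coeff 0 f = 0 := by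
  rw [vars_span, MvPolynomial.mem_ideal_span_X_image]
  constructor
  · intro h
    by_contra h0
    obtain ⟨i, -, hi⟩ := h 0 (MvPolynomial.mem_support_iff.2 h0)
    simp at hi
  · intro h m hm
    by_contra! h1
    have : m = 0 := by ext i; exact h1 i (by simp)
    subst this
    exact MvPolynomial.mem_support_iff.1 hm h

lemma smul_eq (N : Type u) [AddCommGroup N] [Module (MvPolynomial (Fin d) F) N]
    (hN : ∀ (i : Fin d) (x : N), (MvPolynomial.X i : MvPolynomial (Fin d) F) • x = 0)
    (f : MvPolynomial (Fin d) F) (x : N) :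
    f • x = (MvPolynomial.C (MvPolynomial.coeff 0 f) : MvPolynomial (Fin d) F) • x := by
  rw [← sub_eq_zero, ← sub_smul]
  have h1 : f - MvPolynomial.C (MvPolynomial.coeff 0 f) ∈ Ideal.ofList (vars F d) := by
    rw [mem_vars]; simp
  have h2 : Ideal.ofList (vars F d) ≤ Module.annihilator (MvPolynomial (Fin d) F) N := by
    rw [vars_span, Ideal.span_le]
    rintro _ ⟨i, -, rfl⟩
    exact Module.mem_annihilator.2 (hN i)
  exact Module.mem_annihilator.1 (h2 h1) x

lemma exists_equiv (N : Type u) [AddCommGroup N] [Module (MvPolynomial (Fin d) F) N]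
    [Nontrivial N]
    (hN : ∀ (i : Fin d) (x : N), (MvPolynomial.X i : MvPolynomial (Fin d) F) • x = 0) :
    ∃ (ι : Type u) (_ : Nonempty ι), Nonempty (((ι →₀ MvPolynomial (Fin d) F) ⧸
      (Ideal.ofList (vars F d) • (⊤ : Submodule (MvPolynomial (Fin d) F)
        (ι →₀ MvPolynomial (Fin d) F)))) ≃ₗ[MvPolynomial (Fin d) F] N) := by
  let _ : Module F N := Module.compHom N (MvPolynomial.C : F →+* MvPolynomial (Fin d) F)
  have hs : ∀ (c : F) (x : N), c • x = (MvPolynomial.C c : MvPolynomial (Fin d) F) • x :=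
    fun _ _ => rfl
  let b := Module.Free.chooseBasis F N
  let ι := Module.Free.ChooseBasisIndex F N
  let φ : (ι →₀ MvPolynomial (Fin d) F) →ₗ[MvPolynomial (Fin d) F] N :=
    Finsupp.linearCombination _ b
  let c0 : MvPolynomial (Fin d) F →+ F := MvPolynomial.constantCoeff.toAddMonoidHom
  have hφ : ∀ f, φ f = Finsupp.linearCombination F b (f.mapRange c0 (map_zero c0)) := by
    intro f
    rw [Finsupp.linearCombination_apply, Finsupp.linearCombination_apply,
      Finsupp.sum_mapRange_index (h := fun i a => a • b i) (fun _ => zero_smul _ _)]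
    refine Finsupp.sum_congr (fun i _ => ?_)
    exact smul_eq N hN _ _
  have hsurj : Function.Surjective φ := by
    intro x
    refine ⟨(b.repr x).mapRange MvPolynomial.C (map_zero _), ?_⟩
    rw [hφ]
    conv_rhs => rw [← b.linearCombination_repr x]
    congr 1
    ext i
    simp [c0]
  have hker : LinearMap.ker φ = Ideal.ofList (vars F d) • (⊤ : Submodule (MvPolynomial (Fin d) F)
        (ι →₀ MvPolynomial (Fin d) F)) := by
    ext f
    rw [LinearMap.mem_ker, mem_smul_top, hφ]
    have := b.linearIndependent
    rw [linearIndependent_iff] at this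
    constructor
    · intro h i
      have h2 := DFunLike.congr_fun (this _ h) i
      rw [mem_vars]
      exact h2
    · intro h
      have h0 : f.mapRange c0 (map_zero c0) = 0 := by
        ext i
        exact mem_vars.1 (h i)
      rw [h0, map_zero]
  exact ⟨ι, b.index_nonempty, ⟨(Submodule.quotEquivOfEq _ _ hker.symm).trans
    (φ.quotKerEquivOfSurjective hsurj)⟩⟩

theorem poly_ext (N : ModuleCat.{u} (MvPolynomial (Fin d) F)) [Nontrivial N]
    (hN : ∀ (i : Fin d) (x : N), (MvPolynomial.X i : MvPolynomial (Fin d) F) • x = 0) :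
    Nontrivial (Abelian.Ext N (ModuleCat.of _ (MvPolynomial (Fin d) F)) d) ∧
    ∀ n, d < n → Subsingleton (Abelian.Ext N (ModuleCat.of _ (MvPolynomial (Fin d) F)) n) := by
  obtain ⟨ι, _, ⟨e⟩⟩ := exists_equiv N hN
  have hlen : (vars F d).length = d := by simp [vars]
  have hpd : HasProjectiveDimensionLT N (d + 1) := by
    have h1 : HasProjectiveDimensionLT
        (ModuleCat.of (MvPolynomial (Fin d) F) (ι →₀ MvPolynomial (Fin d) F)) 1 := by
      have : Projective
          (ModuleCat.of (MvPolynomial (Fin d) F) (ι →₀ MvPolynomial (Fin d) F)) :=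
        (IsProjective.iff_projective _ ).1 inferInstance
      infer_instance
    have h2 := reg_pd _ _ (vars_regular ι) 1 h1
    rw [hlen, add_comm] at h2
    exact hasProjectiveDimensionLT_of_iso (e.toModuleIso : _ ≅ N) (d + 1)
  have hvan : ∀ (Y : ModuleCat.{u} (MvPolynomial (Fin d) F)) (n : ℕ), d < n →
      Subsingleton (Abelian.Ext N Y n) := fun Y n hn =>
    HasProjectiveDimensionLT.subsingleton N (d+1) n hn Y
  refine ⟨?_, hvan _⟩
  let I : Ideal (MvPolynomial (Fin d) F) := Ideal.ofList (vars F d)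
  let T : ModuleCat.{u} (MvPolynomial (Fin d) F) :=
    ModuleCat.of _ (MvPolynomial (Fin d) F ⧸ I)
  let g : ModuleCat.of _ (MvPolynomial (Fin d) F) ⟶ T := ModuleCat.ofHom (Submodule.mkQ I)
  have hT : Nontrivial (Abelian.Ext N T d) := by
    have hTX : ∀ r ∈ vars F d, ∀ t : T, r • t = 0 := by
      intro r hr t
      obtain ⟨t, rfl⟩ := Submodule.mkQ_surjective I t
      rw [← map_smul]
      refine (Submodule.Quotient.mk_eq_zero I).2 ?_
      exact I.mul_mem_right _ (Ideal.subset_span hr)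
    have h0 : Nontrivial (Abelian.Ext
        (ModuleCat.of (MvPolynomial (Fin d) F) (ι →₀ MvPolynomial (Fin d) F)) T 0) := by
      rw [(Abelian.Ext.homEquiv₀).nontrivial_congr]
      obtain ⟨i⟩ := ‹Nonempty ι›
      let φ : (ι →₀ MvPolynomial (Fin d) F) →ₗ[MvPolynomial (Fin d) F]
        (MvPolynomial (Fin d) F ⧸ I) := (Submodule.mkQ I).comp (Finsupp.lapply i)
      refine ⟨⟨ModuleCat.ofHom φ, 0, fun h => ?_⟩⟩
      have h1 : φ (Finsupp.single i 1) = 0 := by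
        have := congrArg (fun q => q.hom (Finsupp.single i 1)) h
        simpa using this
      have h2 : (1 : MvPolynomial (Fin d) F) ∈ I := by
        rw [← Submodule.Quotient.mk_eq_zero I]
        simpa [φ] using h1
      rw [mem_vars] at h2
      simp at h2
    have := reg_ext T _ (vars F d) hTX (vars_regular ι) 0 h0
    rw [hlen, zero_add] at this
    exact ext_nontrivial_of_iso T (e.symm.toModuleIso : N ≅ _) d this
  have hepi : Epi g := (ModuleCat.epi_iff_surjective g).2 (Submodule.mkQ_surjective I)
  let S := ShortComplex.mk _ _ (Limits.kernel.condition g)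
  have hS : S.ShortExact :=
    { exact := ShortComplex.exact_of_f_is_kernel _ (Limits.kernelIsKernel g) }
  by_contra hcon
  rw [not_nontrivial_iff_subsingleton] at hcon
  obtain ⟨x, hx⟩ := exists_ne (0 : Abelian.Ext N T d)
  have := hvan S.X₁ (d+1) (by omega)
  obtain ⟨y, hy⟩ := Abelian.Ext.covariant_sequence_exact₃ N hS x rfl (Subsingleton.elim _ _)
  apply hx
  have : y = 0 := hcon.elim y 0
  rw [← hy, this]
  simp

end Poly


section PBW

open MvPolynomial Module

variable {F : Type u} [Field F] {d : ℕ}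

/-- monomials -/
noncomputable abbrev zm (F : Type u) [Field F] {d : ℕ} (I : Fin d →₀ ℕ) : MvPolynomial (Fin d) F :=
  monomial I 1

/-- polynomials of degree `< n` -/
noncomputable def fil (F : Type u) [Field F] (d : ℕ) (n : ℕ) :
    Submodule F (MvPolynomial (Fin d) F) :=
  Submodule.span F {f | ∃ I : Fin d →₀ ℕ, I.degree < n ∧ f = zm F I}

lemma zm_zero : zm F (0 : Fin d →₀ ℕ) = 1 := by
  rw [zm, ← C_apply, C_1]

lemma zm_mem {n : ℕ} {I : Fin d →₀ ℕ} (h : I.degree < n) : zm F I ∈ fil F d n :=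
  Submodule.subset_span ⟨I, h, rfl⟩

lemma fil_mono {m n : ℕ} (h : m ≤ n) : fil F d m ≤ fil F d n := by
  refine Submodule.span_mono ?_
  rintro _ ⟨I, hI, rfl⟩
  exact ⟨I, by omega, rfl⟩

lemma mem_fil {n : ℕ} {f : MvPolynomial (Fin d) F} :
    f ∈ fil F d n ↔ ∀ I, coeff I f ≠ 0 → I.degree < n := by
  constructor
  · intro h
    induction h using Submodule.span_induction with
    | mem x hx =>
      obtain ⟨I, hI, rfl⟩ := hx
      intro J hJ
      rw [coeff_monomial] at hJ
      by_cases h : I = J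
      · exact h ▸ hI
      · simp [h] at hJ
    | zero => simp
    | add x y _ _ hx hy =>
      intro I hI
      by_cases h : coeff I x = 0
      · exact hy I (by simpa [h] using hI)
      · exact hx I h
    | smul a x _ hx =>
      intro I hI
      refine hx I (fun h => hI ?_)
      simp [h]
  · intro h
    rw [f.as_sum]
    refine Submodule.sum_mem _ (fun I hI => ?_)
    have : monomial I (coeff I f) = coeff I f • zm F I := by
      simp [zm, smul_monomial]
    rw [this]
    exact Submodule.smul_mem _ _ (zm_mem (h I (by simpa using hI)))

lemma exists_fil (f : MvPolynomial (Fin d) F) : ∃ n, f ∈ fil F d (n + 1) := by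
  refine ⟨f.totalDegree, mem_fil.2 (fun I hI => ?_)⟩
  have := le_totalDegree (p := f) (s := I) (by simpa using hI)
  have h2 : I.degree = I.sum fun _ e => e := rfl
  omega

lemma fil_map {V : Type*} [AddCommGroup V] [Module F V] {n : ℕ}
    (φ : MvPolynomial (Fin d) F →ₗ[F] V) (K : Submodule F V)
    (h : ∀ I : Fin d →₀ ℕ, I.degree < n → φ (zm F I) ∈ K) {f : MvPolynomial (Fin d) F}
    (hf : f ∈ fil F d n) : φ f ∈ K := by
  have : fil F d n ≤ K.comap φ := by
    refine Submodule.span_le.2 ?_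
    rintro _ ⟨I, hI, rfl⟩
    exact h I hI
  exact this hf

lemma fil_eq {V : Type*} [AddCommGroup V] [Module F V] {n : ℕ}
    (φ ψ : MvPolynomial (Fin d) F →ₗ[F] V)
    (h : ∀ I : Fin d →₀ ℕ, I.degree < n → φ (zm F I) = ψ (zm F I)) {f : MvPolynomial (Fin d) F}
    (hf : f ∈ fil F d n) : φ f = ψ f := by
  have := fil_map (φ - ψ) ⊥ (fun I hI => by simp [h I hI]) hf
  simpa [sub_eq_zero] using this

lemma zm_add (I : Fin d →₀ ℕ) (i : Fin d) : zm F (I + Finsupp.single i 1) = X i * zm F I := by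
  rw [zm, zm, X, monomial_mul, add_comm]; simp

lemma X_mul_fil {n : ℕ} (i : Fin d) {f : MvPolynomial (Fin d) F} (hf : f ∈ fil F d n) :
    X i * f ∈ fil F d (n + 1) := by
  refine fil_map (LinearMap.mulLeft F (X i)) (fil F d (n+1)) (fun I hI => ?_) hf
  rw [LinearMap.mulLeft_apply, ← zm_add]
  exact zm_mem (by simp; omega)

/-- `i` is at most every index of `I` -/
def Low (i : Fin d) (I : Fin d →₀ ℕ) : Prop := ∀ k, I k ≠ 0 → i ≤ k

lemma Low.add {i j : Fin d} {I : Fin d →₀ ℕ} (h : Low i I) (hij : i ≤ j) :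
    Low i (I + Finsupp.single j 1) := by
  intro k hk
  by_cases hkj : j = k
  · exact hkj ▸ hij
  · exact h k (by simpa [Finsupp.single_apply, hkj] using hk)

lemma exists_low (I : Fin d →₀ ℕ) (hne : I ≠ 0) :
    ∃ j J, I = J + Finsupp.single j 1 ∧ Low j J ∧ ∀ k, I k ≠ 0 → j ≤ k := by
  have hne : I.support.Nonempty := by simpa using hne
  let j := I.support.min' hne
  have hj : I j ≠ 0 := by simpa using I.support.min'_mem hne
  have hjk : ∀ k, I k ≠ 0 → j ≤ k := fun k hk => I.support.min'_le k (by simpa using hk)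
  have hle : Finsupp.single j 1 ≤ I := by
    rw [Finsupp.single_le_iff]; omega
  refine ⟨j, I - Finsupp.single j 1, (tsub_add_cancel_of_le hle).symm,
    fun l hl => hjk l (fun h0 => hl ?_), hjk⟩
  simp [h0]

lemma low_cases (i : Fin d) (I : Fin d →₀ ℕ) :
    Low i I ∨ ∃ j J, I = J + Finsupp.single j 1 ∧ j < i ∧ Low j J := by
  by_cases h : Low i I
  · exact Or.inl h
  · right
    unfold Low at h
    push Not at h
    obtain ⟨k, hk, hki⟩ := h
    obtain ⟨j, J, h1, h2, h3⟩ := exists_low I (by rintro rfl; simp at hk)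
    exact ⟨j, J, h1, lt_of_le_of_lt (h3 k hk) hki, h2⟩

attribute [local instance] LieRing.ofAssociativeRing

variable {L : Type u} [LieRing L] [LieAlgebra F L] (b : Basis (Fin d) F L)

open Classical in
/-- one step of the recursion -/
noncomputable def stepFun (B : Fin d → (MvPolynomial (Fin d) F →ₗ[F] MvPolynomial (Fin d) F))
    (i : Fin d) (I : Fin d →₀ ℕ) : MvPolynomial (Fin d) F :=
  if h : ∃ j J, I = J + Finsupp.single j 1 ∧ j < i ∧ Low j J then
    X i * zm F I + B h.choose (B i (zm F h.choose_spec.choose) - X i * zm F h.choose_spec.choose)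
      + b.constr F B ⁅b i, b h.choose⁆ (zm F h.choose_spec.choose)
  else X i * zm F I

lemma stepFun_low (B : Fin d → (MvPolynomial (Fin d) F →ₗ[F] MvPolynomial (Fin d) F))
    (i : Fin d) (I : Fin d →₀ ℕ) (h : Low i I) : stepFun b B i I = X i * zm F I := by
  unfold stepFun
  rw [dif_neg]
  rintro ⟨j, J, rfl, hj, -⟩
  have := h j (by simp)
  omega

lemma low_unique {j j' : Fin d} {J J' : Fin d →₀ ℕ}
    (h : J + Finsupp.single j 1 = J' + Finsupp.single j' 1) (hj : Low j J) (hj' : Low j' J') :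
    j = j' ∧ J = J' := by
  have h1 := (hj.add le_rfl) j' (by rw [h]; simp)
  have h2 := (hj'.add le_rfl) j (by rw [← h]; simp)
  have h3 := le_antisymm h1 h2
  subst h3
  exact ⟨rfl, add_right_cancel h⟩

lemma stepFun_high (B : Fin d → (MvPolynomial (Fin d) F →ₗ[F] MvPolynomial (Fin d) F))
    (i j : Fin d) (J : Fin d →₀ ℕ) (hji : j < i) (h : Low j J) :
    stepFun b B i (J + Finsupp.single j 1) = X i * zm F (J + Finsupp.single j 1)
      + B j (B i (zm F J) - X i * zm F J) + b.constr F B ⁅b i, b j⁆ (zm F J) := by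
  have hex : ∃ j' J', J + Finsupp.single j 1 = J' + Finsupp.single j' 1 ∧ j' < i ∧ Low j' J' :=
    ⟨j, J, rfl, hji, h⟩
  unfold stepFun
  rw [dif_pos hex]
  have hs := hex.choose_spec.choose_spec
  obtain ⟨h1, h2⟩ := low_unique hs.1 h hs.2.2
  rw [← h2, ← h1]

/-- truncated operators -/
noncomputable def opA : ℕ → Fin d → (MvPolynomial (Fin d) F →ₗ[F] MvPolynomial (Fin d) F)
  | 0 => fun i => LinearMap.mulLeft F (X i)
  | n + 1 => fun i => (basisMonomials (Fin d) F).constr F (stepFun b (opA n) i)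

lemma constr_zm {V : Type*} [AddCommGroup V] [Module F V] (φ : (Fin d →₀ ℕ) → V)
    (I : Fin d →₀ ℕ) : (basisMonomials (Fin d) F).constr F φ (zm F I) = φ I := by
  have : zm F I = basisMonomials (Fin d) F I := by simp [zm]
  rw [this, Basis.constr_basis]

lemma opA_succ (n : ℕ) (i : Fin d) (I : Fin d →₀ ℕ) :
    opA b (n+1) i (zm F I) = stepFun b (opA b n) i I := constr_zm _ _

lemma constr_apply_mem {V V' : Type*} [AddCommGroup V] [Module F V] [AddCommGroup V'] [Module F V']
    (B : Fin d → (V →ₗ[F] V')) (f : V) (K : Submodule F V')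
    (h : ∀ k, B k f ∈ K) (y : L) : b.constr F B y f ∈ K := by
  rw [Basis.constr_apply_fintype, LinearMap.sum_apply]
  exact Submodule.sum_mem _ (fun k _ => Submodule.smul_mem _ _ (h k))

lemma constr_apply_congr {V V' : Type*} [AddCommGroup V] [Module F V] [AddCommGroup V']
    [Module F V'] (B B' : Fin d → (V →ₗ[F] V')) (f : V)
    (h : ∀ k, B k f = B' k f) (y : L) : b.constr F B y f = b.constr F B' y f := by
  rw [Basis.constr_apply_fintype, LinearMap.sum_apply, Basis.constr_apply_fintype,
    LinearMap.sum_apply]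
  exact Finset.sum_congr rfl (fun k _ => by simp [h k])

lemma opA_deg (n : ℕ) (i : Fin d) {m : ℕ} {f : MvPolynomial (Fin d) F} (hf : f ∈ fil F d m) :
    opA b n i f - X i * f ∈ fil F d m := by
  induction n generalizing i m f with
  | zero => simp [opA]
  | succ n ih =>
    have ih2 : ∀ (i : Fin d) {m : ℕ} {f : MvPolynomial (Fin d) F}, f ∈ fil F d m →
        opA b n i f ∈ fil F d (m+1) := by
      intro i m f hf
      have := Submodule.add_mem _ (fil_mono (Nat.le_succ m) (ih i hf)) (X_mul_fil i hf)
      simpa using this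
    refine fil_map (opA b (n+1) i - LinearMap.mulLeft F (X i)) (fil F d m) (fun I hI => ?_) hf
    rw [LinearMap.sub_apply, LinearMap.mulLeft_apply, opA_succ]
    rcases low_cases i I with h | ⟨j, J, rfl, hj, hJ⟩
    · rw [stepFun_low _ _ _ _ h]; simp
    · rw [stepFun_high _ _ _ _ _ hj hJ]
      have hd : J.degree + 2 ≤ m := by simp at hI; omega
      have hz : zm F J ∈ fil F d (J.degree + 1) := zm_mem (by omega)
      rw [add_assoc, add_sub_cancel_left]
      refine fil_mono hd (Submodule.add_mem _ (ih2 j (ih i hz)) ?_)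
      exact constr_apply_mem b _ _ _ (fun k => ih2 k hz) _

lemma opA_stable (n : ℕ) (i : Fin d) {f : MvPolynomial (Fin d) F} (hf : f ∈ fil F d (n+1)) :
    opA b n i f = opA b (n+1) i f := by
  induction n generalizing i f with
  | zero =>
    refine fil_eq _ _ (fun I hI => ?_) hf
    have hI : I = 0 := by
      have : I.degree = 0 := by omega
      exact (Finsupp.degree_eq_zero_iff I).1 this
    subst hI
    rw [opA_succ, stepFun_low _ _ _ _ (by intro k hk; simp at hk)]
    simp [opA]
  | succ n ih =>
    refine fil_eq _ _ (fun I hI => ?_) hf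
    rw [opA_succ, opA_succ]
    rcases low_cases i I with h | ⟨j, J, rfl, hj, hJ⟩
    · rw [stepFun_low _ _ _ _ h, stepFun_low _ _ _ _ h]
    · rw [stepFun_high _ _ _ _ _ hj hJ, stepFun_high _ _ _ _ _ hj hJ]
      have hz : zm F J ∈ fil F d (n + 1) := zm_mem (by simp at hI; omega)
      rw [← ih i hz, ← ih j (opA_deg b n i hz),
        constr_apply_congr b (opA b n) (opA b (n+1)) (zm F J) (fun k => ih k hz)]

lemma opA_stable_le {n m : ℕ} (hnm : n ≤ m) (i : Fin d) {f : MvPolynomial (Fin d) F}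
    (hf : f ∈ fil F d (n+1)) : opA b n i f = opA b m i f := by
  induction m, hnm using Nat.le_induction with
  | base => rfl
  | succ m hm ih => rw [ih, opA_stable b m i (fil_mono (by omega) hf)]

/-- the operators -/
noncomputable def op (i : Fin d) : MvPolynomial (Fin d) F →ₗ[F] MvPolynomial (Fin d) F :=
  (basisMonomials (Fin d) F).constr F (fun I => opA b I.degree i (zm F I))

lemma op_eq (n : ℕ) (i : Fin d) {f : MvPolynomial (Fin d) F} (hf : f ∈ fil F d (n+1)) :
    op b i f = opA b n i f := by
  refine fil_eq _ _ (fun I hI => ?_) hf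
  unfold op
  rw [constr_zm]
  exact opA_stable_le b (by omega) i (zm_mem (by omega))

lemma op_deg (i : Fin d) {m : ℕ} {f : MvPolynomial (Fin d) F} (hf : f ∈ fil F d m) :
    op b i f - X i * f ∈ fil F d m := by
  rw [op_eq b m i (fil_mono (by omega) hf)]
  exact opA_deg b m i hf

lemma op_low (i : Fin d) (I : Fin d →₀ ℕ) (h : Low i I) : op b i (zm F I) = X i * zm F I := by
  rw [op_eq b (I.degree + 1) i (zm_mem (by omega)), opA_succ, stepFun_low _ _ _ _ h]

/-- the action of the Lie algebra -/
noncomputable def act : L →ₗ[F] (MvPolynomial (Fin d) F →ₗ[F] MvPolynomial (Fin d) F) :=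
  b.constr F (op b)

lemma act_basis (i : Fin d) : act b (b i) = op b i := by
  simp [act]

lemma op_high (i j : Fin d) (J : Fin d →₀ ℕ) (hji : j < i) (h : Low j J) :
    op b i (op b j (zm F J)) = op b j (op b i (zm F J)) + act b ⁅b i, b j⁆ (zm F J) := by
  rw [op_low b j J h, ← zm_add]
  have hz : zm F J ∈ fil F d (J.degree + 1) := zm_mem (by omega)
  rw [op_eq b (J.degree + 1) i (zm_mem (by simp)), opA_succ, stepFun_high _ _ _ _ _ hji h,
    ← op_eq b _ i hz, ← op_eq b _ j (op_deg b i hz), map_sub, act,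
    constr_apply_congr b (op b) (opA b J.degree) (zm F J) (fun k => op_eq b _ k hz),
    ← zm_add J i, op_low b j _ (h.add hji.le), zm_add, zm_add]
  ring

lemma act_deg (x : L) {m : ℕ} {f : MvPolynomial (Fin d) F} (hf : f ∈ fil F d m) :
    act b x f ∈ fil F d (m + 1) := by
  refine constr_apply_mem b _ _ _ (fun i => ?_) x
  have := Submodule.add_mem _ (fil_mono (Nat.le_succ m) (op_deg b i hf)) (X_mul_fil i hf)
  simpa using this

lemma comm_of_basis (s : MvPolynomial (Fin d) F)
    (h : ∀ i j, j < i → op b i (op b j s) = op b j (op b i s) + act b ⁅b i, b j⁆ s) (x y : L) :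
    act b x (act b y s) = act b y (act b x s) + act b ⁅x, y⁆ s := by
  let B : L →ₗ[F] L →ₗ[F] MvPolynomial (Fin d) F :=
    LinearMap.mk₂ F (fun x y => act b x (act b y s) - (act b y (act b x s) + act b ⁅x, y⁆ s))
      (by intros; simp; abel) (by intros; simp [smul_sub]) (by intros; simp; abel)
      (by intros; simp [smul_sub])
  suffices hB : B = 0 by
    have := LinearMap.congr_fun₂ hB x y
    exact sub_eq_zero.1 this
  refine b.ext (fun i => b.ext (fun j => ?_))
  simp only [B, LinearMap.mk₂_apply, LinearMap.zero_apply, act_basis]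
  rcases lt_trichotomy i j with hij | rfl | hij
  · rw [h j i hij, ← lie_skew (b j) (b i)]
    simp only [map_neg, LinearMap.neg_apply]
    abel
  · simp
  · rw [h i j hij]; simp

lemma act_comm (n : ℕ) {s : MvPolynomial (Fin d) F} (hs : s ∈ fil F d n) (x y : L) :
    act b x (act b y s) = act b y (act b x s) + act b ⁅x, y⁆ s := by
  induction n generalizing s x y with
  | zero =>
    have : s = 0 := by
      ext I
      by_contra h
      simpa using mem_fil.1 hs I h
    simp [this]
  | succ n ih =>
    refine fil_eq (act b x ∘ₗ act b y) (act b y ∘ₗ act b x + act b ⁅x, y⁆) (fun I hI => ?_) hs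
    refine comm_of_basis b (zm F I) (fun i j hji => ?_) x y
    rcases low_cases j I with h | ⟨k, J, rfl, hkj, hJ⟩
    · exact op_high b i j I hji h
    · have hJn : J.degree + 1 ≤ n := by simp at hI; omega
      have hz : zm F J ∈ fil F d n := zm_mem (by omega)
      have hz1 : zm F J ∈ fil F d (J.degree + 1) := zm_mem (by omega)
      have key : ∀ i j, k < i → k < j → op b i (op b k (op b j (zm F J))) =
          op b k (op b i (op b j (zm F J))) + act b ⁅b i, b k⁆ (op b j (zm F J)) := by
        intro i j hi hj
        have h1 := op_high b i k (J + Finsupp.single j 1) hi (hJ.add hj.le)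
        have h2 := ih (fil_mono hJn (op_deg b j hz1)) (b i) (b k)
        rw [act_basis, act_basis] at h2
        rw [zm_add] at h1
        simp only [map_sub] at h2
        rw [h1] at h2
        linear_combination (exp := 1) h2
      have e : ∀ i j, k < i → k < j → op b i (op b j (op b k (zm F J))) =
          op b k (op b i (op b j (zm F J))) + act b ⁅b i, b k⁆ (op b j (zm F J))
          + act b ⁅b j, b k⁆ (op b i (zm F J)) + act b ⁅b i, ⁅b j, b k⁆⁆ (zm F J) := by
        intro i j hi hj
        have h1 := ih hz (b j) (b k)
        have h2 := ih hz (b i) ⁅b j, b k⁆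
        rw [act_basis, act_basis] at h1
        rw [act_basis] at h2
        rw [h1, map_add, key i j hi hj, h2]
        abel
      have hI' : zm F (J + Finsupp.single k 1) = op b k (zm F J) := by
        rw [zm_add, op_low b k J hJ]
      rw [hI', e i j (hkj.trans hji) hkj, e j i hkj (hkj.trans hji)]
      have h3 := ih hz (b i) (b j)
      have h4 := ih hz ⁅b i, b j⁆ (b k)
      rw [act_basis, act_basis] at h3
      rw [act_basis, lie_lie, map_sub, LinearMap.sub_apply] at h4
      rw [h3, h4, map_add]
      abel

/-- the representation of the Lie algebra -/
noncomputable def rep : L →ₗ⁅F⁆ Module.End F (MvPolynomial (Fin d) F) :=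
  { act b with
    map_lie' := by
      intro x y
      refine LinearMap.ext (fun s => ?_)
      obtain ⟨n, hn⟩ := exists_fil s
      have := act_comm b _ hn x y
      simp only [LieRing.of_associative_ring_bracket, LinearMap.sub_apply, Module.End.mul_apply]
      change act b ⁅x, y⁆ s = act b x (act b y s) - act b y (act b x s)
      rw [this]; abel }

/-- representation of the enveloping algebra -/
noncomputable def repU : UniversalEnvelopingAlgebra F L →ₐ[F]
    Module.End F (MvPolynomial (Fin d) F) :=
  UniversalEnvelopingAlgebra.lift F (rep b)

/-- the generators -/
noncomputable abbrev gen (i : Fin d) : UniversalEnvelopingAlgebra F L :=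
  UniversalEnvelopingAlgebra.ι F (b i)

lemma repU_ι (x : L) : repU b (UniversalEnvelopingAlgebra.ι F x) = act b x := by
  unfold repU
  rw [UniversalEnvelopingAlgebra.lift_ι_apply]
  rfl

lemma repU_gen (i : Fin d) : repU b (gen b i) = op b i := by
  rw [repU_ι, act_basis]

lemma subalg_top {F L : Type*} [CommRing F] [LieRing L] [LieAlgebra F L]
    (A : Subalgebra F (UniversalEnvelopingAlgebra F L))
    (h : ∀ x, UniversalEnvelopingAlgebra.ι F x ∈ A) : A = ⊤ := by
  let f : L →ₗ⁅F⁆ A :=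
    { toFun := fun x => ⟨UniversalEnvelopingAlgebra.ι F x, h x⟩
      map_add' := fun x y => by ext; simp
      map_smul' := fun x y => by ext; simp
      map_lie' := by intro x y; ext; simp [LieRing.of_associative_ring_bracket] }
  have : A.val.comp (UniversalEnvelopingAlgebra.lift F f) =
      AlgHom.id F (UniversalEnvelopingAlgebra F L) := by
    apply UniversalEnvelopingAlgebra.hom_ext
    ext x
    simp [f]
  rw [eq_top_iff]
  intro u _
  have h2 := DFunLike.congr_fun this u
  rw [AlgHom.id_apply] at h2
  rw [← h2]
  exact Subtype.property _

lemma ofFn_mul {M : Type*} [Monoid M] : ∀ {d : ℕ} (x : Fin d → M) (e : Fin d → ℕ) (i : Fin d),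
    (∀ k, e k ≠ 0 → i ≤ k) → x i * (List.ofFn (fun k => x k ^ e k)).prod =
      (List.ofFn (fun k => x k ^ (e + (Pi.single i 1 : Fin _ → ℕ)) k)).prod
  | 0, _, _, i, _ => i.elim0
  | d + 1, x, e, i, h => by
    rw [List.ofFn_succ, List.ofFn_succ, List.prod_cons, List.prod_cons]
    refine Fin.cases (fun h => ?_) (fun i h => ?_) i h
    · have : ∀ k : Fin d, (Pi.single (0 : Fin (d+1)) 1 : Fin (d+1) → ℕ) k.succ = 0 := by
        intro k; simp
      simp only [Pi.add_apply, this, Pi.single_eq_same, add_zero, pow_succ', mul_assoc]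
    · have h0 : e 0 = 0 := by
        by_contra h0
        have := h 0 h0
        simp at this
      have ih := ofFn_mul (fun k => x k.succ) (fun k => e k.succ) i
        (fun k hk => by simpa using h _ hk)
      have h1 : ∀ k : Fin d, (Pi.single (i.succ : Fin (d+1)) 1 : Fin (d+1) → ℕ) k.succ
          = (Pi.single i 1 : Fin d → ℕ) k := by
        intro k; simp [Pi.single_apply]
      have h2 : (Pi.single (i.succ : Fin (d+1)) 1 : Fin (d+1) → ℕ) 0 = 0 := by
        simp [(Fin.succ_ne_zero i).symm]
      simp only [Pi.add_apply, h0, h1, h2, pow_zero, one_mul, add_zero] at ih ⊢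
      exact ih

/-- ordered monomials -/
noncomputable def omon (I : Fin d →₀ ℕ) : UniversalEnvelopingAlgebra F L :=
  (List.ofFn (fun k => gen b k ^ I k)).prod

lemma omon_low (i : Fin d) (I : Fin d →₀ ℕ) (h : Low i I) :
    gen b i * omon b I = omon b (I + Finsupp.single i 1) := by
  unfold omon
  rw [ofFn_mul (gen b) I i h]
  congr 2
  ext k
  simp [Finsupp.single_apply, Pi.single_apply, eq_comm]

lemma omon_zero : omon b 0 = 1 := by
  simp [omon]

lemma repU_omon (I : Fin d →₀ ℕ) : repU b (omon b I) 1 = zm F I := by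
  induction hn : I.degree generalizing I with
  | zero =>
    rw [Finsupp.degree_eq_zero_iff] at hn
    subst hn
    rw [omon_zero, map_one (repU b), Module.End.one_apply, zm_zero]
  | succ n ih =>
    obtain ⟨j, J, rfl, hJ, -⟩ := exists_low I (by rintro rfl; simp at hn)
    rw [← omon_low b j J hJ, map_mul, Module.End.mul_apply, ih J (by simp at hn; omega), repU_gen,
      op_low b j J hJ, zm_add]

/-- the map from polynomials to the enveloping algebra -/
noncomputable def pbw : MvPolynomial (Fin d) F →ₗ[F] UniversalEnvelopingAlgebra F L :=
  (basisMonomials (Fin d) F).constr F (omon b)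

lemma pbw_zm (I : Fin d →₀ ℕ) : pbw b (zm F I) = omon b I := constr_zm _ _

lemma gen_mul_pbw_low (i : Fin d) (I : Fin d →₀ ℕ) (h : Low i I) :
    gen b i * pbw b (zm F I) = pbw b (op b i (zm F I)) := by
  rw [op_low b i I h, ← zm_add, pbw_zm, pbw_zm, omon_low b i I h]

lemma ι_mul_pbw_of (s : MvPolynomial (Fin d) F)
    (h : ∀ i, gen b i * pbw b s = pbw b (op b i s)) (x : L) :
    UniversalEnvelopingAlgebra.ι F x * pbw b s = pbw b (act b x s) := by
  let f : L →ₗ[F] UniversalEnvelopingAlgebra F L :=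
    (LinearMap.mulRight F (pbw b s)).comp
      (UniversalEnvelopingAlgebra.ι F : L →ₗ⁅F⁆ UniversalEnvelopingAlgebra F L).toLinearMap
  let g : L →ₗ[F] UniversalEnvelopingAlgebra F L :=
    (pbw b).comp ((act b).flip s)
  have : f = g := b.ext (fun i => by
    have := h i
    simp only [f, g, LinearMap.comp_apply, LinearMap.flip_apply, act_basis, ← this]
    rfl)
  exact DFunLike.congr_fun this x

lemma ι_mul_pbw (n : ℕ) {s : MvPolynomial (Fin d) F} (hs : s ∈ fil F d n) (x : L) :
    UniversalEnvelopingAlgebra.ι F x * pbw b s = pbw b (act b x s) := by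
  induction n generalizing s x with
  | zero =>
    have : s = 0 := by
      ext I
      by_contra h
      simpa using mem_fil.1 hs I h
    simp [this]
  | succ n ih =>
    refine fil_eq ((LinearMap.mulLeft F (UniversalEnvelopingAlgebra.ι F x)).comp (pbw b))
      ((pbw b).comp (act b x)) (fun I hI => ?_) hs
    refine ι_mul_pbw_of b (zm F I) (fun i => ?_) x
    rcases low_cases i I with h | ⟨j, J, rfl, hji, hJ⟩
    · exact gen_mul_pbw_low b i I h
    · have hJn : J.degree + 1 ≤ n := by simp at hI; omega
      have hz : zm F J ∈ fil F d n := zm_mem (by omega)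
      have hz1 : zm F J ∈ fil F d (J.degree + 1) := zm_mem (by omega)
      have hI' : zm F (J + Finsupp.single j 1) = op b j (zm F J) := by
        rw [zm_add, op_low b j J hJ]
      rw [hI', ← gen_mul_pbw_low b j J hJ, op_high b i j J hji hJ, map_add,
        ← ih hz ⁅b i, b j⁆, LieHom.map_lie, LieRing.of_associative_ring_bracket]
      have h1 : gen b i * pbw b (zm F J) = pbw b (op b i (zm F J)) := by
        have := ih hz (b i)
        rwa [act_basis] at this
      have h2 : pbw b (op b j (op b i (zm F J))) = gen b j * pbw b (op b i (zm F J)) := by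
        have h3 := gen_mul_pbw_low b j (J + Finsupp.single i 1) (hJ.add hji.le)
        have h4 := ih (fil_mono hJn (op_deg b i hz1)) (b j)
        rw [act_basis] at h4
        rw [zm_add] at h3
        simp only [map_sub, mul_sub] at h4
        rw [h3] at h4
        exact (sub_left_injective h4).symm
      rw [h2, ← h1, sub_mul, mul_assoc, mul_assoc]
      abel

lemma mul_pbw (u : UniversalEnvelopingAlgebra F L) (s : MvPolynomial (Fin d) F) :
    u * pbw b s = pbw b (repU b u s) := by
  let A : Subalgebra F (UniversalEnvelopingAlgebra F L) :=
    { carrier := {u | ∀ s, u * pbw b s = pbw b (repU b u s)}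
      mul_mem' := by
        intro u v hu hv s
        rw [mul_assoc, hv, hu, map_mul, Module.End.mul_apply]
      add_mem' := by
        intro u v hu hv s
        rw [add_mul, hv, hu, map_add, LinearMap.add_apply, map_add]
      algebraMap_mem' := by
        intro r s
        rw [AlgHom.commutes, Algebra.algebraMap_eq_smul_one, Algebra.algebraMap_eq_smul_one]
        simp }
  have hA : A = ⊤ := subalg_top A (fun x s => by
    obtain ⟨n, hn⟩ := exists_fil s
    rw [repU_ι]
    exact ι_mul_pbw b _ hn x)
  have : u ∈ A := hA ▸ Algebra.mem_top
  exact this s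

lemma pbw_one : pbw b 1 = 1 := by
  rw [← zm_zero, pbw_zm, omon_zero]

lemma pbw_repU (u : UniversalEnvelopingAlgebra F L) : pbw b (repU b u 1) = u := by
  rw [← mul_pbw, pbw_one, mul_one]

lemma repU_pbw (s : MvPolynomial (Fin d) F) : repU b (pbw b s) 1 = s := by
  have : ((LinearMap.applyₗ (1 : MvPolynomial (Fin d) F)).comp
      (repU b).toLinearMap).comp (pbw b) = LinearMap.id := by
    refine (basisMonomials (Fin d) F).ext (fun I => ?_)
    have h := repU_omon b I
    rw [← pbw_zm] at h
    simpa using h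
  exact DFunLike.congr_fun this s

/-- the PBW isomorphism -/
noncomputable def pbwEquiv : UniversalEnvelopingAlgebra F L ≃ₗ[F] MvPolynomial (Fin d) F :=
  { (LinearMap.applyₗ (1 : MvPolynomial (Fin d) F)).comp (repU b).toLinearMap with
    invFun := pbw b
    left_inv := pbw_repU b
    right_inv := repU_pbw b }

lemma pbwEquiv_apply (u : UniversalEnvelopingAlgebra F L) : pbwEquiv b u = repU b u 1 := rfl

end PBW


section Symb

open MvPolynomial Module

attribute [local instance] LieRing.ofAssociativeRing

variable {F : Type u} [Field F] {d : ℕ}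
variable {L : Type u} [LieRing L] [LieAlgebra F L] (b : Basis (Fin d) F L)

lemma fil_zero {f : MvPolynomial (Fin d) F} (hf : f ∈ fil F d 0) : f = 0 := by
  ext I
  by_contra h
  simpa using mem_fil.1 hf I h

lemma mul_fil {n m : ℕ} {s f : MvPolynomial (Fin d) F} (hs : s ∈ fil F d (n+1))
    (hf : f ∈ fil F d m) : s * f ∈ fil F d (n + m) := by
  refine fil_map (LinearMap.mulRight F f) (fil F d (n+m)) (fun I hI => ?_) hs
  refine fil_map (LinearMap.mulLeft F (zm F I)) (fil F d (n+m)) (fun J hJ => ?_) hf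
  rw [LinearMap.mulLeft_apply, zm, zm, monomial_mul, one_mul]
  exact zm_mem (by rw [map_add]; omega)

/-- elements acting with degree `< n` -/
def Lower (n : ℕ) (u : UniversalEnvelopingAlgebra F L) : Prop :=
  ∀ m, ∀ f ∈ fil F d (m+1), repU b u f ∈ fil F d (n + m)

/-- `u` has symbol `s` in degree `n` -/
def Symb (n : ℕ) (u : UniversalEnvelopingAlgebra F L) (s : MvPolynomial (Fin d) F) : Prop :=
  s ∈ fil F d (n+1) ∧ ∀ m, ∀ f ∈ fil F d (m+1), repU b u f - s * f ∈ fil F d (n + m)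

variable {b}

lemma Symb.lower {n : ℕ} {u : UniversalEnvelopingAlgebra F L} {s : MvPolynomial (Fin d) F}
    (h : Symb b n u s) : Lower b (n+1) u := by
  intro m f hf
  have := Submodule.add_mem _ (fil_mono (by omega : n + m ≤ n + 1 + m) (h.2 m f hf))
    (fil_mono (by omega : n + (m+1) ≤ n + 1 + m) (mul_fil h.1 hf))
  simpa using this

lemma Symb.map {n m : ℕ} {u : UniversalEnvelopingAlgebra F L} {s : MvPolynomial (Fin d) F}
    (h : Symb b n u s) {f : MvPolynomial (Fin d) F} (hf : f ∈ fil F d m) :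
    repU b u f ∈ fil F d (n + m) := by
  cases m with
  | zero => rw [fil_zero hf]; simp
  | succ m => exact fil_mono (by omega) (h.lower m f hf)

lemma Symb.mul {n k : ℕ} {u v : UniversalEnvelopingAlgebra F L} {s t : MvPolynomial (Fin d) F}
    (hu : Symb b n u s) (hv : Symb b k v t) : Symb b (n + k) (u * v) (s * t) := by
  refine ⟨fil_mono (by omega) (mul_fil hu.1 hv.1), fun m f hf => ?_⟩
  have h1 := hu.map (hv.2 m f hf)
  have h2 := hu.2 (k + m) (t * f) (fil_mono (by omega) (mul_fil hv.1 hf))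
  have := Submodule.add_mem _ (fil_mono (by omega : _ ≤ n + k + m) h1)
    (fil_mono (by omega : _ ≤ n + k + m) h2)
  rw [map_sub] at this
  rw [map_mul, Module.End.mul_apply, mul_assoc]
  convert this using 1
  abel

lemma Symb.one : Symb b 0 1 1 := by
  refine ⟨?_, fun m f hf => by simp⟩
  rw [← zm_zero]
  exact zm_mem (by simp)

lemma Symb.pow {n : ℕ} {u : UniversalEnvelopingAlgebra F L} {s : MvPolynomial (Fin d) F}
    (h : Symb b n u s) (k : ℕ) : Symb b (k * n) (u ^ k) (s ^ k) := by
  induction k with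
  | zero => simpa using Symb.one
  | succ k ih =>
    rw [pow_succ, pow_succ, add_mul, one_mul]
    exact ih.mul h

lemma Symb.add {n : ℕ} {u v : UniversalEnvelopingAlgebra F L} {s : MvPolynomial (Fin d) F}
    (h : Symb b n u s) (hv : Lower b n v) : Symb b n (u + v) s := by
  refine ⟨h.1, fun m f hf => ?_⟩
  have := Submodule.add_mem _ (h.2 m f hf) (hv m f hf)
  rw [map_add, LinearMap.add_apply]
  convert this using 1
  abel

lemma Symb.gen (i : Fin d) : Symb b 1 (gen b i) (X i) := by
  refine ⟨?_, fun m f hf => ?_⟩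
  · have := zm_add (F := F) 0 i
    rw [zm_zero, mul_one] at this
    rw [← this]
    exact zm_mem (by simp)
  · rw [repU_gen, add_comm]
    exact op_deg b i hf

lemma Symb.poly (i : Fin d) (q : Polynomial F) (hq : q.Monic) :
    Symb b q.natDegree (Polynomial.aeval (UGr.gen b i) q) (X i ^ q.natDegree) := by
  conv => arg 3; rw [hq.as_sum]
  rw [map_add, map_sum]
  have h1 := (Symb.gen (b := b) i).pow q.natDegree
  rw [mul_one] at h1
  simp only [map_pow, Polynomial.aeval_X]
  refine h1.add ?_
  intro m f hf
  rw [map_sum, LinearMap.sum_apply]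
  refine Submodule.sum_mem _ (fun j hj => ?_)
  rw [Finset.mem_range] at hj
  have h2 := ((Symb.gen (b := b) i).pow j).lower m f hf
  rw [mul_one] at h2
  have : Polynomial.aeval (UGr.gen b i) (Polynomial.C (q.coeff j) * Polynomial.X ^ j) =
      q.coeff j • (UGr.gen b i) ^ j := by
    rw [map_mul, map_pow, Polynomial.aeval_X, Polynomial.aeval_C, Algebra.smul_def]
  rw [this, map_smul, LinearMap.smul_apply]
  exact Submodule.smul_mem _ _ (fil_mono (by omega) h2)

lemma Symb.omon (I : Fin d →₀ ℕ) : Symb b I.degree (omon b I) (zm F I) := by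
  induction hn : I.degree generalizing I with
  | zero =>
    rw [Finsupp.degree_eq_zero_iff] at hn
    subst hn
    rw [omon_zero, zm_zero]
    exact Symb.one
  | succ n ih =>
    obtain ⟨j, J, rfl, hJ, -⟩ := exists_low I (by rintro rfl; simp at hn)
    rw [← omon_low b j J hJ, zm_add, add_comm]
    exact (Symb.gen j).mul (ih J (by simp at hn; omega))

lemma Symb.apply_one {n : ℕ} {u : UniversalEnvelopingAlgebra F L} {s : MvPolynomial (Fin d) F}
    (h : Symb b n u s) : repU b u 1 - s ∈ fil F d n := by
  have := h.2 0 1 (by rw [← zm_zero]; exact zm_mem (by simp))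
  simpa using this

/-- unitriangular maps are bijective -/
lemma unitri (T : MvPolynomial (Fin d) F →ₗ[F] MvPolynomial (Fin d) F)
    (h : ∀ I, T (zm F I) - zm F I ∈ fil F d I.degree) :
    (∀ n, ∀ f ∈ fil F d (n+1), T f - f ∈ fil F d n) ∧ (∀ f, T f = 0 → f = 0) ∧
    ∀ n, ∀ f ∈ fil F d n, ∃ g ∈ fil F d n, T g = f ∧ ∀ m, n = m + 1 → f - g ∈ fil F d m := by
  have h1 : ∀ n, ∀ f ∈ fil F d (n+1), T f - f ∈ fil F d n := fun n f hf =>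
    fil_map (T - LinearMap.id) (fil F d n) (fun I hI => fil_mono (by omega) (h I)) hf
  refine ⟨h1, ?_, ?_⟩
  · have : ∀ n, ∀ f ∈ fil F d n, T f = 0 → f = 0 := by
      intro n
      induction n with
      | zero => intro f hf _; exact fil_zero hf
      | succ n ih =>
        intro f hf h0
        have := h1 n f hf
        rw [h0, zero_sub] at this
        exact ih f (by simpa using this) h0
    intro f
    obtain ⟨n, hn⟩ := exists_fil f
    exact this _ f hn
  · intro n
    induction n with
    | zero =>
      intro f hf
      exact ⟨0, Submodule.zero_mem _, by simp [fil_zero hf], fun m hm => by omega⟩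
    | succ n ih =>
      intro f hf
      obtain ⟨g, hg, hg2, -⟩ := ih _ (h1 n f hf)
      refine ⟨f - g, Submodule.sub_mem _ hf (fil_mono (by omega) hg), ?_, fun m hm => ?_⟩
      · rw [map_sub, hg2]; abel
      · obtain rfl : n = m := by omega
        simpa using hg

end Symb


section Free

open MvPolynomial Module

attribute [local instance] LieRing.ofAssociativeRing

variable {F : Type u} [Field F] {d : ℕ}

/-- exponents -/
noncomputable def av {k : Fin d → ℕ} (a : (i : Fin d) → Fin (k i)) : Fin d →₀ ℕ :=
  Finsupp.equivFunOnFinite.symm (fun i => (a i : ℕ))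

/-- scaled exponents -/
noncomputable def kc (k : Fin d → ℕ) (m : Fin d →₀ ℕ) : Fin d →₀ ℕ :=
  Finsupp.equivFunOnFinite.symm (fun i => k i * m i)

/-- remainder -/
def rm {k : Fin d → ℕ} (hk : ∀ i, 0 < k i) (I : Fin d →₀ ℕ) : (i : Fin d) → Fin (k i) :=
  fun i => ⟨I i % k i, Nat.mod_lt _ (hk i)⟩

/-- quotient -/
noncomputable def qt (k : Fin d → ℕ) (I : Fin d →₀ ℕ) : Fin d →₀ ℕ :=
  Finsupp.equivFunOnFinite.symm (fun i => I i / k i)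

lemma av_rm {k : Fin d → ℕ} (hk : ∀ i, 0 < k i) (I : Fin d →₀ ℕ) :
    kc k (qt k I) + av (rm hk I) = I := by
  ext i
  simp [av, rm, kc, qt, Nat.div_add_mod]

lemma rm_add {k : Fin d → ℕ} (hk : ∀ i, 0 < k i) (a : (i : Fin d) → Fin (k i)) (m : Fin d →₀ ℕ) :
    rm hk (kc k m + av a) = a := by
  ext i
  simp [av, rm, kc, Nat.mod_eq_of_lt]

lemma qt_add {k : Fin d → ℕ} (hk : ∀ i, 0 < k i) (a : (i : Fin d) → Fin (k i)) (m : Fin d →₀ ℕ) :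
    qt k (kc k m + av a) = m := by
  ext i
  simp [av, qt, kc, Nat.mul_add_div (hk i)]

lemma av_inj {k : Fin d → ℕ} {a a' : (i : Fin d) → Fin (k i)} (h : av a = av a') : a = a' := by
  ext i
  have := DFunLike.congr_fun h i
  simpa [av] using this

lemma zm_mul (I J : Fin d →₀ ℕ) : zm F (I + J) = zm F I * zm F J := by
  rw [zm, zm, zm, monomial_mul, one_mul]

lemma kc_zero (k : Fin d → ℕ) : kc k 0 = 0 := by ext i; simp [kc]

lemma kc_add (k : Fin d → ℕ) (m m' : Fin d →₀ ℕ) : kc k (m + m') = kc k m + kc k m' := by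
  ext i; simp [kc, mul_add]

lemma kc_single (k : Fin d → ℕ) (i : Fin d) (n : ℕ) :
    kc k (Finsupp.single i n) = Finsupp.single i (n * k i) := by
  ext j
  by_cases h : i = j
  · subst h; simp [kc, mul_comm]
  · simp [kc, h]

variable {L : Type u} [LieRing L] [LieAlgebra F L] {b : Basis (Fin d) F L}

variable {k : Fin d → ℕ} (hk : ∀ i, 0 < k i) {w : Fin d → UniversalEnvelopingAlgebra F L}
  (hw : ∀ i, Symb b (k i) (w i) (X i ^ k i)) (hc : ∀ i u, u * w i = w i * u)

/-- the structure map -/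
noncomputable def wmap : MvPolynomial (Fin d) F →ₐ[F] UniversalEnvelopingAlgebra F L :=
  (Subalgebra.val _).comp (MvPolynomial.aeval (fun i =>
    (⟨w i, Subalgebra.mem_center_iff.2 (hc i)⟩ :
      Subalgebra.center F (UniversalEnvelopingAlgebra F L))))

lemma wmap_X (i : Fin d) : wmap hc (X i) = w i := by
  simp [wmap]

lemma wmap_comm (f : MvPolynomial (Fin d) F) (u : UniversalEnvelopingAlgebra F L) :
    wmap hc f * u = u * wmap hc f := by
  have : wmap hc f ∈ Subalgebra.center F (UniversalEnvelopingAlgebra F L) := Subtype.property _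
  exact (Subalgebra.mem_center_iff.1 this u).symm

include hw in
lemma Symb.wmap (m : Fin d →₀ ℕ) : Symb b (kc k m).degree (wmap hc (zm F m)) (zm F (kc k m)) := by
  induction m using Finsupp.induction_linear with
  | zero =>
    rw [kc_zero, zm_zero, map_one (UGr.wmap hc)]
    simpa using Symb.one
  | add f g hf hg =>
    rw [kc_add, zm_mul, zm_mul, map_mul, map_add]
    exact hf.mul hg
  | single i n =>
    have h1 : zm F (Finsupp.single i n) = X i ^ n := by rw [zm, X_pow_eq_monomial]
    have h2 : zm F (kc k (Finsupp.single i n)) = (X i ^ k i) ^ n := by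
      rw [kc_single, ← pow_mul, zm, X_pow_eq_monomial, mul_comm]
    rw [h1, h2, map_pow, wmap_X, kc_single, Finsupp.degree_single]
    exact (hw i).pow n

/-- the comparison map -/
noncomputable def tmap : MvPolynomial (Fin d) F →ₗ[F] MvPolynomial (Fin d) F :=
  (basisMonomials (Fin d) F).constr F
    (fun I => repU b (wmap hc (zm F (qt k I)) * omon b (av (rm hk I))) 1)

lemma tmap_zm (I : Fin d →₀ ℕ) : tmap (b := b) hk hc (zm F I) =
    repU b (wmap hc (zm F (qt k I)) * omon b (av (rm hk I))) 1 := constr_zm _ _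

lemma pbw_tmap (I : Fin d →₀ ℕ) : pbw b (tmap (b := b) hk hc (zm F I)) =
    wmap hc (zm F (qt k I)) * omon b (av (rm hk I)) := by
  rw [tmap_zm, pbw_repU]

include hw in
lemma tmap_tri (I : Fin d →₀ ℕ) :
    tmap (b := b) hk hc (zm F I) - zm F I ∈ fil F d I.degree := by
  have := ((Symb.wmap hw hc (qt k I)).mul (Symb.omon (b := b) (av (rm hk I)))).apply_one
  rw [← zm_mul, av_rm, ← map_add, av_rm] at this
  rwa [tmap_zm]

/-- coordinate functions -/
noncomputable def rmap (a : (i : Fin d) → Fin (k i)) :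
    MvPolynomial (Fin d) F →ₗ[F] MvPolynomial (Fin d) F :=
  (basisMonomials (Fin d) F).constr F (fun I => if rm hk I = a then zm F (qt k I) else 0)

/-- expansion -/
noncomputable def emap (k : Fin d → ℕ) : MvPolynomial (Fin d) F →ₗ[F] MvPolynomial (Fin d) F :=
  (basisMonomials (Fin d) F).constr F (fun m => zm F (kc k m))

lemma rmap_emap (a a' : (i : Fin d) → Fin (k i)) (g : MvPolynomial (Fin d) F) :
    rmap hk a (emap k g * zm F (av a')) = if a' = a then g else 0 := by
  have : (rmap hk a).comp ((LinearMap.mulRight F (zm F (av a'))).comp (emap k)) =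
      if a' = a then LinearMap.id else 0 := by
    refine (basisMonomials (Fin d) F).ext (fun m => ?_)
    rw [coe_basisMonomials]
    change rmap hk a (emap k (zm F m) * zm F (av a')) = _
    rw [emap, constr_zm, ← zm_mul, rmap, constr_zm, rm_add, qt_add hk]
    split_ifs <;> rfl
  have := DFunLike.congr_fun this g
  simp only [LinearMap.comp_apply, LinearMap.mulRight_apply] at this
  rw [this]
  split_ifs <;> rfl

lemma tmap_emap (a : (i : Fin d) → Fin (k i)) (g : MvPolynomial (Fin d) F) :
    tmap (b := b) hk hc (emap k g * zm F (av a)) = repU b (wmap hc g * omon b (av a)) 1 := by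
  have : (pbw b).comp ((tmap (b := b) hk hc).comp
      ((LinearMap.mulRight F (zm F (av a))).comp (emap k))) =
      (LinearMap.mulRight F (omon b (av a))).comp (wmap hc).toLinearMap := by
    refine (basisMonomials (Fin d) F).ext (fun m => ?_)
    rw [show basisMonomials (Fin d) F m = zm F m by rw [coe_basisMonomials]]
    simp only [LinearMap.comp_apply, LinearMap.mulRight_apply, AlgHom.toLinearMap_apply]
    rw [emap, constr_zm, ← zm_mul, pbw_tmap, rm_add, qt_add hk]
  have h2 := DFunLike.congr_fun this g
  simp only [LinearMap.comp_apply, LinearMap.mulRight_apply, AlgHom.toLinearMap_apply] at h2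
  rw [← h2, repU_pbw]

/-- the algebra structure -/
@[reducible]
noncomputable def walg : Algebra (MvPolynomial (Fin d) F) (UniversalEnvelopingAlgebra F L) :=
  RingHom.toAlgebra' (wmap hc).toRingHom (wmap_comm hc)

lemma walg_smul (g : MvPolynomial (Fin d) F) (u : UniversalEnvelopingAlgebra F L) :
    let _ := walg hc
    g • u = wmap hc g * u := rfl

include hk hw in
lemma lin_indep :
    let _ := walg hc
    LinearIndependent (MvPolynomial (Fin d) F)
      (fun a : (i : Fin d) → Fin (k i) => omon b (av a)) := by
  intro _
  rw [Fintype.linearIndependent_iff]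
  intro c h a
  have h1 : tmap (b := b) hk hc (∑ a, emap k (c a) * zm F (av a)) = 0 := by
    rw [map_sum]
    simp only [tmap_emap]
    rw [← LinearMap.sum_apply, ← map_sum]
    have : ∑ a, wmap hc (c a) * omon b (av a) = 0 := h
    rw [this, map_zero, LinearMap.zero_apply]
  have h2 := (unitri _ (tmap_tri hk hw hc)).2.1 _ h1
  have h3 := congrArg (rmap hk a) h2
  rw [map_sum, map_zero] at h3
  simpa [rmap_emap] using h3

include hk hw in
lemma span_top :
    let _ := walg hc
    ⊤ ≤ Submodule.span (MvPolynomial (Fin d) F)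
      (Set.range (fun a : (i : Fin d) → Fin (k i) => omon b (av a))) := by
  intro _ u _
  obtain ⟨n, hn⟩ := exists_fil (repU b u 1)
  obtain ⟨g, hg, hg1, -⟩ := (unitri _ (tmap_tri hk hw hc)).2.2 _ _ hn
  have hu : u = pbw b (tmap (b := b) hk hc g) := by rw [hg1, pbw_repU]
  rw [hu, g.as_sum, map_sum, map_sum]
  refine Submodule.sum_mem _ (fun I _ => ?_)
  have : monomial I (coeff I g) = coeff I g • zm F I := by
    simp [zm, smul_monomial]
  rw [this, map_smul, map_smul, pbw_tmap, ← smul_mul_assoc, ← map_smul]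
  exact Submodule.smul_mem _ _ (Submodule.subset_span ⟨_, rfl⟩)

/-- the basis over the polynomial ring -/
noncomputable def wbasis :
    let _ := walg hc
    Basis ((i : Fin d) → Fin (k i)) (MvPolynomial (Fin d) F) (UniversalEnvelopingAlgebra F L) :=
  let _ := walg hc
  Basis.mk (lin_indep hk hw hc) (span_top hk hw hc)

lemma wbasis_apply (a : (i : Fin d) → Fin (k i)) :
    let _ := walg hc
    wbasis hk hw hc a = omon b (av a) := by
  intro _
  exact Basis.mk_apply (lin_indep hk hw hc) (span_top hk hw hc) a

lemma coord_tmap (a : (i : Fin d) → Fin (k i)) (f : MvPolynomial (Fin d) F) :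
    let _ := walg hc
    (wbasis hk hw hc).coord a (pbw b (tmap (b := b) hk hc f)) = rmap hk a f := by
  intro _
  have ht : IsScalarTower F (MvPolynomial (Fin d) F) (UniversalEnvelopingAlgebra F L) :=
    IsScalarTower.of_algebraMap_eq (fun r => ((wmap hc).commutes r).symm)
  have : (((wbasis hk hw hc).coord a).restrictScalars F).comp
      ((pbw b).comp (tmap (b := b) hk hc)) = rmap hk a := by
    refine (basisMonomials (Fin d) F).ext (fun I => ?_)
    rw [coe_basisMonomials]
    change (wbasis hk hw hc).coord a (pbw b (tmap (b := b) hk hc (zm F I))) = rmap hk a (zm F I)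
    have h1 : pbw b (tmap (b := b) hk hc (zm F I)) = zm F (qt k I) • (wbasis hk hw hc (rm hk I)) := by
      rw [pbw_tmap, wbasis_apply]
      rfl
    rw [h1, map_smul, Basis.coord_apply, Basis.repr_self, rmap, constr_zm, Finsupp.single_apply]
    split_ifs <;> simp
  exact DFunLike.congr_fun this f

end Free


section Frob

open MvPolynomial Module

attribute [local instance] LieRing.ofAssociativeRing

lemma frob_abs {W R ι : Type*} [CommRing W] [Ring R] [Algebra W R] [Fintype ι] [DecidableEq ι]
    (B B' : Basis ι W R) (τ : R →ₗ[W] W)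
    (hdet : IsUnit (Matrix.of fun a c => τ (B a * B' c)).det) (φ : R →ₗ[W] W) :
    ∃! y, ∀ u, τ (u * y) = φ u := by
  set G : Matrix ι ι W := Matrix.of fun a c => τ (B a * B' c) with hG
  have key : ∀ y a, τ (B a * y) = G.mulVec (B'.equivFun y) a := by
    intro y a
    conv_lhs => rw [← B'.sum_equivFun y]
    rw [Finset.mul_sum, map_sum]
    simp only [Matrix.mulVec, dotProduct, hG, Matrix.of_apply, mul_smul_comm, map_smul, smul_eq_mul]
    exact Finset.sum_congr rfl (fun _ _ => mul_comm _ _)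
  have red : ∀ y, (∀ u, τ (u * y) = φ u) ↔ G.mulVec (B'.equivFun y) = fun a => φ (B a) := by
    intro y
    constructor
    · intro h
      funext a
      rw [← key, h]
    · intro h
      have : τ.comp (LinearMap.mulRight W y) = φ := by
        refine B.ext (fun a => ?_)
        rw [LinearMap.comp_apply, LinearMap.mulRight_apply, key, h]
      intro u
      exact DFunLike.congr_fun this u
  simp only [red]
  refine ⟨B'.equivFun.symm (G⁻¹.mulVec (fun a => φ (B a))), ?_, ?_⟩
  · simp only [LinearEquiv.apply_symm_apply]
    rw [Matrix.mulVec_mulVec, Matrix.mul_nonsing_inv _ hdet, Matrix.one_mulVec]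
  · intro y hy
    rw [← hy, Matrix.mulVec_mulVec, Matrix.nonsing_inv_mul _ hdet, Matrix.one_mulVec,
      LinearEquiv.symm_apply_apply]

variable {F : Type u} [Field F] {d : ℕ}

/-- top exponent -/
def tp {k : Fin d → ℕ} (hk : ∀ i, 0 < k i) : (i : Fin d) → Fin (k i) :=
  fun i => ⟨k i - 1, Nat.sub_lt (hk i) one_pos⟩

/-- complement -/
def rv (k : Fin d → ℕ) : ((i : Fin d) → Fin (k i)) ≃ ((i : Fin d) → Fin (k i)) where
  toFun a i := (a i).rev
  invFun a i := (a i).rev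
  left_inv a := by simp
  right_inv a := by simp

lemma av_add_rv {k : Fin d → ℕ} (hk : ∀ i, 0 < k i) (a : (i : Fin d) → Fin (k i)) :
    av a + av (rv k a) = av (tp hk) := by
  ext i
  simp [av, rv, tp]
  omega

lemma coeff_zm [DecidableEq (Fin d →₀ ℕ)] (I J : Fin d →₀ ℕ) :
    coeff I (zm F J) = if J = I then 1 else 0 := by
  rw [zm, coeff_monomial]
  split_ifs <;> rfl

lemma coeff_fil {n : ℕ} {f : MvPolynomial (Fin d) F} (hf : f ∈ fil F d n) {I : Fin d →₀ ℕ}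
    (hI : n ≤ I.degree) : coeff I f = 0 := by
  by_contra h
  have := mem_fil.1 hf I h
  omega

lemma rmap_top {k : Fin d → ℕ} (hk : ∀ i, 0 < k i) {f : MvPolynomial (Fin d) F}
    (hf : f ∈ fil F d ((av (tp hk)).degree + 1)) :
    rmap hk (tp hk) f = C (coeff (av (tp hk)) f) := by
  classical
  refine fil_eq (rmap hk (tp hk)) ((Algebra.linearMap F (MvPolynomial (Fin d) F)).comp
    (lcoeff F (av (tp hk)))) (fun I hI => ?_) hf
  rw [rmap, constr_zm, LinearMap.comp_apply, lcoeff_apply, coeff_zm, Algebra.linearMap_apply]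
  by_cases h : rm hk I = tp hk
  · have h1 := av_rm hk I
    rw [h] at h1
    have h2 := congrArg Finsupp.degree h1
    rw [map_add] at h2
    have h3 : (kc k (qt k I)).degree = 0 := by omega
    rw [Finsupp.degree_eq_zero_iff] at h3
    rw [h3, zero_add] at h1
    have h4 : qt k I = 0 := by
      rw [← h1]
      have := qt_add hk (tp hk) 0
      rwa [kc_zero, zero_add] at this
    rw [if_pos h, if_pos h1.symm, h4, zm_zero, map_one]
  · rw [if_neg h, if_neg, map_zero]
    rintro rfl
    apply h
    have := rm_add hk (tp hk) 0
    rwa [kc_zero, zero_add] at this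

variable {L : Type u} [LieRing L] [LieAlgebra F L] {b : Basis (Fin d) F L}

variable {k : Fin d → ℕ} (hk : ∀ i, 0 < k i) {w : Fin d → UniversalEnvelopingAlgebra F L}
  (hw : ∀ i, Symb b (k i) (w i) (X i ^ k i)) (hc : ∀ i u, u * w i = w i * u)

lemma tau_low {u : UniversalEnvelopingAlgebra F L}
    (hu : repU b u 1 ∈ fil F d ((av (tp hk)).degree + 1)) :
    let _ := walg hc
    (wbasis hk hw hc).coord (tp hk) u = C (coeff (av (tp hk)) (repU b u 1)) := by
  intro _
  obtain ⟨g, hg, hg1, hg2⟩ := (unitri _ (tmap_tri hk hw hc)).2.2 _ _ hu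
  have hu1 : u = pbw b (tmap (b := b) hk hc g) := by rw [hg1, pbw_repU]
  have h1 := coord_tmap hk hw hc (tp hk) g
  rw [← hu1] at h1
  refine h1.trans ?_
  rw [rmap_top hk hg]
  have := coeff_fil (hg2 _ rfl) le_rfl
  rw [coeff_sub, sub_eq_zero] at this
  rw [this]

lemma gram (a c : (i : Fin d) → Fin (k i)) (h : (av a).degree ≤ (av c).degree) :
    let _ := walg hc
    (wbasis hk hw hc).coord (tp hk) (omon b (av a) * omon b (av (rv k c))) =
      if a = c then 1 else 0 := by
  classical
  intro _
  have h1 := (Symb.omon (b := b) (av a)).mul (Symb.omon (b := b) (av (rv k c)))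
  have h2 := h1.apply_one
  rw [← zm_mul] at h2
  have hd := congrArg Finsupp.degree (av_add_rv hk c)
  rw [map_add] at hd
  have h3 : repU b (omon b (av a) * omon b (av (rv k c))) 1 ∈
      fil F d ((av (tp hk)).degree + 1) := by
    have := Submodule.add_mem _ (fil_mono (by omega : _ ≤ (av (tp hk)).degree + 1) h2)
      (zm_mem (F := F) (I := av a + av (rv k c)) (n := (av (tp hk)).degree + 1)
        (by rw [map_add]; omega))
    simpa using this
  refine (tau_low hk hw hc h3).trans ?_
  have h4 := coeff_fil (fil_mono (by omega : _ ≤ (av (tp hk)).degree) h2) le_rfl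
  rw [coeff_sub, sub_eq_zero] at h4
  rw [h4, coeff_zm, ← av_add_rv hk c]
  by_cases hac : a = c
  · simp [hac]
  · rw [if_neg hac, if_neg, map_zero]
    intro h5
    exact hac (av_inj (add_right_cancel h5))

lemma frob_det [DecidableEq ((i : Fin d) → Fin (k i))] :
    let _ := walg hc
    (Matrix.of fun a c => (wbasis hk hw hc).coord (tp hk)
      (wbasis hk hw hc a * (wbasis hk hw hc).reindex (rv k) c)).det = 1 := by
  intro _
  set G := (Matrix.of fun a c => (wbasis hk hw hc).coord (tp hk)
      (wbasis hk hw hc a * (wbasis hk hw hc).reindex (rv k) c)) with hG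
  have hg : ∀ a c, (av a).degree ≤ (av c).degree → G a c = if a = c then 1 else 0 := by
    intro a c h
    rw [hG, Matrix.of_apply, Basis.reindex_apply]
    have h1 := wbasis_apply hk hw hc a
    have h2 := wbasis_apply hk hw hc ((rv k).symm c)
    simp only at h1 h2
    rw [h1, h2]
    refine (gram hk hw hc a c h).trans ?_
    split_ifs <;> rfl
  have ht : G.BlockTriangular (fun a => OrderDual.toDual (av a).degree) := by
    intro a c h
    have h' : (av a).degree < (av c).degree := h
    rw [hg a c h'.le, if_neg]
    rintro rfl
    exact lt_irrefl _ h'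
  rw [ht.det]
  refine Finset.prod_eq_one (fun e _ => ?_)
  have : G.toSquareBlock (fun a => OrderDual.toDual (av a).degree) e = 1 := by
    ext ⟨a, ha⟩ ⟨c, hc'⟩
    have h1 : (av a).degree = (av c).degree := by
      have := ha.trans hc'.symm
      simpa using this
    rw [Matrix.toSquareBlock_def, Matrix.of_apply, hg a c h1.le, Matrix.one_apply]
    simp
  rw [this, Matrix.det_one]

lemma frob (φ : let _ := walg hc
    UniversalEnvelopingAlgebra F L →ₗ[MvPolynomial (Fin d) F] MvPolynomial (Fin d) F) :
    let _ := walg hc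
    ∃! y, ∀ u, (wbasis hk hw hc).coord (tp hk) (u * y) = φ u := by
  classical
  intro _
  refine frob_abs (wbasis hk hw hc) ((wbasis hk hw hc).reindex (rv k)) _ ?_ φ
  have := frob_det hk hw hc
  simp only at this
  rw [this]
  exact isUnit_one

end Frob


section Central

open Module

attribute [local instance] LieRing.ofAssociativeRing

variable {F : Type u} [Field F] {L : Type u} [LieRing L] [LieAlgebra F L]

lemma central_of_ι {c : UniversalEnvelopingAlgebra F L}
    (h : ∀ z : L, UniversalEnvelopingAlgebra.ι F z * c = c * UniversalEnvelopingAlgebra.ι F z)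
    (u : UniversalEnvelopingAlgebra F L) : u * c = c * u := by
  have := subalg_top (Subalgebra.centralizer F {c}) (fun z => by
    rw [Subalgebra.mem_centralizer_iff]
    intro g hg
    rw [Set.mem_singleton_iff] at hg
    subst hg
    exact (h z).symm)
  have hu : u ∈ Subalgebra.centralizer F {c} := this ▸ Algebra.mem_top
  rw [Subalgebra.mem_centralizer_iff] at hu
  exact (hu c rfl).symm

lemma comm_pow (p : ℕ) [Fact p.Prime] [CharP F p] [Nontrivial (UniversalEnvelopingAlgebra F L)]
    (x z : L) (j : ℕ) :
    (UniversalEnvelopingAlgebra.ι F x) ^ (p ^ j) * UniversalEnvelopingAlgebra.ι F z -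
      UniversalEnvelopingAlgebra.ι F z * (UniversalEnvelopingAlgebra.ι F x) ^ (p ^ j) =
    UniversalEnvelopingAlgebra.ι F (((LieAlgebra.ad F L x) ^ (p ^ j)) z) := by
  set U := UniversalEnvelopingAlgebra F L
  set X : U := UniversalEnvelopingAlgebra.ι F x with hX
  have : CharP (Module.End F U) p :=
    charP_of_injective_algebraMap (algebraMap F (Module.End F U)).injective p
  have hcomm : Commute (LinearMap.mulLeft F X) (LinearMap.mulRight F X) :=
    LinearMap.commute_mulLeft_right X X
  have h1 := sub_pow_char_pow_of_commute (p := p) j hcomm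
  have h2 : ∀ n : ℕ, ∀ z : L, ((LinearMap.mulLeft F X - LinearMap.mulRight F X) ^ n)
      (UniversalEnvelopingAlgebra.ι F z) =
      UniversalEnvelopingAlgebra.ι F (((LieAlgebra.ad F L x) ^ n) z) := by
    intro n
    induction n with
    | zero => intro z; simp
    | succ n ih =>
      intro z
      rw [pow_succ, pow_succ, Module.End.mul_apply, Module.End.mul_apply, ← ih]
      congr 1
      rw [LinearMap.sub_apply, LinearMap.mulLeft_apply, LinearMap.mulRight_apply,
        LieAlgebra.ad_apply, LieHom.map_lie, LieRing.of_associative_ring_bracket]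
  rw [← h2, h1, LinearMap.sub_apply, LinearMap.pow_mulLeft, LinearMap.pow_mulRight,
    LinearMap.mulLeft_apply, LinearMap.mulRight_apply]

lemma exists_central (p : ℕ) [Fact p.Prime] [CharP F p] [FiniteDimensional F L]
    [Nontrivial (UniversalEnvelopingAlgebra F L)] (x : L) :
    ∃ q : Polynomial F, q.Monic ∧ 0 < q.natDegree ∧ ∀ u : UniversalEnvelopingAlgebra F L,
      u * Polynomial.aeval (UniversalEnvelopingAlgebra.ι F x) q =
        Polynomial.aeval (UniversalEnvelopingAlgebra.ι F x) q * u := by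
  have hdep : ¬ LinearIndependent F (fun j : ℕ => (LieAlgebra.ad F L x) ^ (p ^ j)) := by
    intro h
    have := h.finite
    exact not_finite ℕ
  rw [not_linearIndependent_iff] at hdep
  obtain ⟨s, g, hs, i, his, hi⟩ := hdep
  have hp : 1 < p := (Fact.out : p.Prime).one_lt
  set q : Polynomial F := ∑ j ∈ s, Polynomial.C (g j) * Polynomial.X ^ (p ^ j) with hq
  have hcoeff : q.coeff (p ^ i) = g i := by
    rw [hq, Polynomial.finsetSum_coeff, Finset.sum_eq_single i]
    · simp
    · intro j _ hj
      rw [Polynomial.coeff_C_mul_X_pow, if_neg]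
      intro h
      exact hj (Nat.pow_right_injective hp h).symm
    · intro h; exact absurd his h
  have hq0 : q ≠ 0 := by
    intro h
    rw [h, Polynomial.coeff_zero] at hcoeff
    exact hi hcoeff.symm
  have hdeg : 0 < q.natDegree :=
    lt_of_lt_of_le (Nat.pow_pos (Nat.zero_lt_of_lt hp) : 0 < p ^ i) (Polynomial.le_natDegree_of_ne_zero (by rwa [hcoeff]))
  refine ⟨q * Polynomial.C q.leadingCoeff⁻¹, Polynomial.monic_mul_leadingCoeff_inv hq0, ?_, ?_⟩
  · rwa [Polynomial.natDegree_mul_leadingCoeff_inv _ hq0]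
  · refine central_of_ι (fun z => ?_)
    have hz : Polynomial.aeval (UniversalEnvelopingAlgebra.ι F x) q *
        UniversalEnvelopingAlgebra.ι F z =
        UniversalEnvelopingAlgebra.ι F z * Polynomial.aeval (UniversalEnvelopingAlgebra.ι F x) q := by
      rw [← sub_eq_zero]
      have h1 : Polynomial.aeval (UniversalEnvelopingAlgebra.ι F x) q =
          ∑ j ∈ s, g j • (UniversalEnvelopingAlgebra.ι F x) ^ (p ^ j) := by
        rw [hq, map_sum]
        refine Finset.sum_congr rfl (fun j _ => ?_)
        rw [map_mul, map_pow, Polynomial.aeval_X, Polynomial.aeval_C, Algebra.smul_def]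
      rw [h1, Finset.sum_mul, Finset.mul_sum, ← Finset.sum_sub_distrib]
      simp only [smul_mul_assoc, mul_smul_comm, ← smul_sub, comm_pow]
      have h2 := congrArg (fun T : Module.End F L => UniversalEnvelopingAlgebra.ι F (T z)) hs
      simpa [LinearMap.sum_apply] using h2
    rw [map_mul, Polynomial.aeval_C]
    exact Commute.mul_right (show Commute _ _ from hz.symm)
      (show Commute _ _ from (Algebra.commutes _ _).symm)

end Central


section Null

open MvPolynomial Module

lemma null {F : Type*} [Field F] {d : ℕ} {Q : Type*} [Ring Q] [Nontrivial Q]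
    [Algebra (MvPolynomial (Fin d) F) Q] [Module.Finite (MvPolynomial (Fin d) F) Q]
    (hunit : ∀ a : Q, (∀ u, u * a = a * u) → a ≠ 0 → IsUnit a) (i : Fin d) :
    ∃ f : Polynomial F, f.Monic ∧
      algebraMap (MvPolynomial (Fin d) F) Q (Polynomial.aeval (X i : MvPolynomial (Fin d) F) f) = 0 := by
  let W := MvPolynomial (Fin d) F
  let K := Subalgebra.center W Q
  have hK : IsField K := by
    refine ⟨⟨0, 1, zero_ne_one⟩, mul_comm, ?_⟩
    intro a ha
    have hac := Subalgebra.mem_center_iff.1 a.2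
    obtain ⟨v, hv⟩ := hunit a hac (fun h => ha (Subtype.ext h))
    refine ⟨⟨(v⁻¹ : Qˣ), Subalgebra.mem_center_iff.2 (fun u => ?_)⟩, Subtype.ext ?_⟩
    · have : Commute u (v : Q) := by rw [hv]; exact hac u
      exact this.units_inv_right
    · change (a : Q) * (v⁻¹ : Qˣ) = 1
      rw [← hv, Units.mul_inv]
  have hintegral : Algebra.IsIntegral W K := by
    refine ⟨fun x => ?_⟩
    have h1 : IsIntegral W (x : Q) := IsIntegral.of_finite W _
    exact (isIntegral_algHom_iff K.val Subtype.val_injective).1 h1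
  have hb : (⊥ : Ideal K).IsMaximal := by
    let _ := hK.toField
    exact Ideal.bot_isMaximal
  let P : Ideal W := (⊥ : Ideal K).comap (algebraMap W K)
  have hP : P.IsMaximal := Ideal.isMaximal_comap_of_isIntegral_of_isMaximal' (algebraMap W K)
    (fun x => hintegral.isIntegral x) (⊥ : Ideal K)
  obtain ⟨f, hf, hf0⟩ := MvPolynomial.quotient_mk_comp_C_isIntegral_of_isJacobsonRing P
    (Ideal.Quotient.mk P (X i))
  refine ⟨f, hf, ?_⟩
  have h2 : Polynomial.aeval (X i : MvPolynomial (Fin d) F) f ∈ P := by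
    rw [← Ideal.Quotient.eq_zero_iff_mem, ← hf0, Polynomial.aeval_def, Polynomial.hom_eval₂]
    rfl
  have h3 : algebraMap W K (Polynomial.aeval (X i : MvPolynomial (Fin d) F) f) = 0 := h2
  exact congrArg Subtype.val h3

end Null


section Final

open MvPolynomial Module

attribute [local instance] LieRing.ofAssociativeRing

lemma unit_quot {U : Type*} [Ring U] (M : Ideal U) [M.IsTwoSided]
    (hmax : ∀ J : Ideal U, (∀ a ∈ J, ∀ x : U, a * x ∈ J) → M < J → J = ⊤)
    (a : U ⧸ M) (ha : ∀ u, u * a = a * u) (h0 : a ≠ 0) : IsUnit a := by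
  obtain ⟨α, rfl⟩ := Ideal.Quotient.mk_surjective a
  have hJ := hmax (Ideal.comap (Ideal.Quotient.mk M) (Ideal.span {Ideal.Quotient.mk M α})) ?_ ?_
  · have h1 : (1 : U) ∈ Ideal.comap (Ideal.Quotient.mk M) (Ideal.span {Ideal.Quotient.mk M α}) := by
      rw [hJ]; exact Submodule.mem_top
    rw [Ideal.mem_comap, Ideal.mem_span_singleton', map_one] at h1
    obtain ⟨v, hv⟩ := h1
    exact ⟨⟨_, v, by rw [← ha, hv], hv⟩, rfl⟩
  · intro c hc x
    rw [Ideal.mem_comap, Ideal.mem_span_singleton'] at hc ⊢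
    obtain ⟨v, hv⟩ := hc
    exact ⟨v * Ideal.Quotient.mk M x, by rw [map_mul, ← hv, mul_assoc, mul_assoc, ha]⟩
  · refine lt_of_le_of_ne ?_ ?_
    · intro m hm
      rw [Ideal.mem_comap, Ideal.Quotient.eq_zero_iff_mem.2 hm]
      exact Submodule.zero_mem _
    · intro h
      apply h0
      rw [Ideal.Quotient.eq_zero_iff_mem, h, Ideal.mem_comap]
      exact Ideal.subset_span rfl

variable {F : Type u} [Field F] {d : ℕ}
variable {L : Type u} [LieRing L] [LieAlgebra F L] (b : Basis (Fin d) F L)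

lemma exists_in_ideal (M : Ideal (UniversalEnvelopingAlgebra F L)) [M.IsTwoSided] (hM : M ≠ ⊤)
    (hmax : ∀ J : Ideal (UniversalEnvelopingAlgebra F L),
      (∀ a ∈ J, ∀ x : UniversalEnvelopingAlgebra F L, a * x ∈ J) → M < J → J = ⊤)
    (q : Fin d → Polynomial F) (hq : ∀ i, (q i).Monic) (hpos : ∀ i, 0 < (q i).natDegree)
    (hc : ∀ i (u : UniversalEnvelopingAlgebra F L),
      u * Polynomial.aeval (gen b i) (q i) = Polynomial.aeval (gen b i) (q i) * u) (i : Fin d) :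
    ∃ f : Polynomial F, f.Monic ∧
      Polynomial.aeval (Polynomial.aeval (gen b i) (q i)) f ∈ M := by
  let _ := walg hc
  have : Nontrivial (UniversalEnvelopingAlgebra F L ⧸ M) := Ideal.Quotient.nontrivial_iff.2 hM
  have hfin : Module.Finite (MvPolynomial (Fin d) F) (UniversalEnvelopingAlgebra F L) :=
    Module.Finite.of_basis (wbasis hpos (fun i => Symb.poly (b := b) i (q i) (hq i)) hc)
  obtain ⟨f, hf, h0⟩ := null (F := F) (d := d) (Q := UniversalEnvelopingAlgebra F L ⧸ M)
    (unit_quot M hmax) i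
  refine ⟨f, hf, ?_⟩
  rw [← Ideal.Quotient.eq_zero_iff_mem, ← h0]
  change _ = Ideal.Quotient.mk M (wmap hc (Polynomial.aeval (X i) f))
  have h1 := Polynomial.aeval_algHom_apply (wmap hc) (X i) f
  rw [wmap_X] at h1
  rw [h1]

lemma main_aux (w : Fin d → UniversalEnvelopingAlgebra F L) (k : Fin d → ℕ)
    (hk : ∀ i, 0 < k i) (hw : ∀ i, Symb b (k i) (w i) (X i ^ k i))
    (hc : ∀ i u, u * w i = w i * u)
    (M : Ideal (UniversalEnvelopingAlgebra F L)) [M.IsTwoSided] (hM : M ≠ ⊤)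
    (hwM : ∀ i, w i ∈ M) :
    Nontrivial (((Ext F (ModuleCat.{u} (UniversalEnvelopingAlgebra F L)) d).obj
      (Opposite.op (ModuleCat.of (UniversalEnvelopingAlgebra F L)
        (UniversalEnvelopingAlgebra F L ⧸ M)))).obj
      (ModuleCat.of (UniversalEnvelopingAlgebra F L) (UniversalEnvelopingAlgebra F L))) ∧
    ∀ n, d < n →
    Subsingleton (((Ext F (ModuleCat.{u} (UniversalEnvelopingAlgebra F L)) n).obj
      (Opposite.op (ModuleCat.of (UniversalEnvelopingAlgebra F L)
        (UniversalEnvelopingAlgebra F L ⧸ M)))).obj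
      (ModuleCat.of (UniversalEnvelopingAlgebra F L) (UniversalEnvelopingAlgebra F L))) := by
  let _ := walg hc
  have hfree : Module.Free (MvPolynomial (Fin d) F) (UniversalEnvelopingAlgebra F L) :=
    Module.Free.of_basis (wbasis hk hw hc)
  have key := ext_frob (F := F) ((wbasis hk hw hc).coord (tp hk)) (frob hk hw hc)
    (ModuleCat.of (UniversalEnvelopingAlgebra F L) (UniversalEnvelopingAlgebra F L ⧸ M))
  have hnt : Nontrivial (UniversalEnvelopingAlgebra F L ⧸ M) := Ideal.Quotient.nontrivial_iff.2 hM
  have : Nontrivial ((ModuleCat.restrictScalars.{u} (algebraMap (MvPolynomial (Fin d) F)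
    (UniversalEnvelopingAlgebra F L))).obj (ModuleCat.of (UniversalEnvelopingAlgebra F L)
      (UniversalEnvelopingAlgebra F L ⧸ M))) := hnt
  have hp := poly_ext ((ModuleCat.restrictScalars.{u} (algebraMap (MvPolynomial (Fin d) F)
    (UniversalEnvelopingAlgebra F L))).obj (ModuleCat.of (UniversalEnvelopingAlgebra F L)
      (UniversalEnvelopingAlgebra F L ⧸ M))) (by
    intro i x
    obtain ⟨y, rfl⟩ : ∃ y, (Ideal.Quotient.mk M y : UniversalEnvelopingAlgebra F L ⧸ M) = x :=
      Ideal.Quotient.mk_surjective x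
    change wmap hc (X i) • (Ideal.Quotient.mk M y) = 0
    rw [wmap_X]
    change Ideal.Quotient.mk M (w i * y) = 0
    rw [Ideal.Quotient.eq_zero_iff_mem]
    exact Ideal.mul_mem_right _ _ (hwM i))
  refine ⟨?_, fun n hn => (key n).2 (hp.2 n hn)⟩
  rw [← not_subsingleton_iff_nontrivial, key d, not_subsingleton_iff_nontrivial]
  exact hp.1

include b in
lemma main_thm (p : ℕ) [Fact p.Prime] [CharP F p]
    (M : Ideal (UniversalEnvelopingAlgebra F L)) [M.IsTwoSided] (hM : M ≠ ⊤)
    (hmax : ∀ J : Ideal (UniversalEnvelopingAlgebra F L),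
      (∀ a ∈ J, ∀ x : UniversalEnvelopingAlgebra F L, a * x ∈ J) → M < J → J = ⊤) :
    Nontrivial (((Ext F (ModuleCat.{u} (UniversalEnvelopingAlgebra F L)) d).obj
      (Opposite.op (ModuleCat.of (UniversalEnvelopingAlgebra F L)
        (UniversalEnvelopingAlgebra F L ⧸ M)))).obj
      (ModuleCat.of (UniversalEnvelopingAlgebra F L) (UniversalEnvelopingAlgebra F L))) ∧
    ∀ n, d < n →
    Subsingleton (((Ext F (ModuleCat.{u} (UniversalEnvelopingAlgebra F L)) n).obj
      (Opposite.op (ModuleCat.of (UniversalEnvelopingAlgebra F L)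
        (UniversalEnvelopingAlgebra F L ⧸ M)))).obj
      (ModuleCat.of (UniversalEnvelopingAlgebra F L) (UniversalEnvelopingAlgebra F L))) := by
  have hfd : FiniteDimensional F L := Module.Finite.of_basis b
  have hnt : Nontrivial (UniversalEnvelopingAlgebra F L ⧸ M) := Ideal.Quotient.nontrivial_iff.2 hM
  have : Nontrivial (UniversalEnvelopingAlgebra F L) :=
    (Ideal.Quotient.mk_surjective (I := M)).nontrivial
  choose q hq hpos hc using fun i => exists_central (F := F) p (b i)
  choose f hf hfM using exists_in_ideal b M hM hmax q hq hpos hc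
  have hfpos : ∀ i, 0 < (f i).natDegree := by
    intro i
    rw [Nat.pos_iff_ne_zero]
    intro h0
    have h1 := Polynomial.eq_one_of_monic_natDegree_zero (hf i) h0
    have h2 := hfM i
    rw [h1, map_one] at h2
    exact hM ((Ideal.eq_top_iff_one M).2 h2)
  refine main_aux b (fun i => Polynomial.aeval (gen b i) ((f i).comp (q i)))
    (fun i => ((f i).comp (q i)).natDegree) ?_ ?_ ?_ M hM ?_
  · intro i
    rw [Polynomial.natDegree_comp]
    exact Nat.mul_pos (hfpos i) (hpos i)
  · intro i
    exact Symb.poly i _ ((hf i).comp (hq i) (hpos i).ne')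
  · intro i u
    rw [Polynomial.aeval_comp]
    have h1 : Polynomial.aeval (gen b i) (q i) ∈
      Subalgebra.center F (UniversalEnvelopingAlgebra F L) := Subalgebra.mem_center_iff.2 (hc i)
    have h2 := Polynomial.aeval_algHom_apply
      (Subalgebra.center F (UniversalEnvelopingAlgebra F L)).val
      (⟨_, h1⟩ : Subalgebra.center F (UniversalEnvelopingAlgebra F L)) (f i)
    rw [Subalgebra.val_apply] at h2
    rw [h2]
    exact Subalgebra.mem_center_iff.1 (Subtype.property _) u
  · intro i
    rw [Polynomial.aeval_comp]
    exact hfM i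

end Final

end UGr

/-- Let `𝔞` be a finite-dimensional Lie algebra over a field `F` of prime
characteristic and let `M` be a maximal two-sided ideal of `U(𝔞)`.  Then
`Ext^d_{U(𝔞)}(U(𝔞)/M, U(𝔞)) ≠ 0` and `Ext^n_{U(𝔞)}(U(𝔞)/M, U(𝔞)) = 0` for `n > d`,
where `d = dim_F 𝔞`; i.e. the upper grade of every maximal ideal equals `dim_F 𝔞`. -/
theorem upper_grade_of_maximal_ideal
    (F : Type u) [Field F] (p : ℕ) [Fact p.Prime] [CharP F p]
    (L : Type u) [LieRing L] [LieAlgebra F L] [FiniteDimensional F L]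
    (M : Ideal (UniversalEnvelopingAlgebra F L))
    (htwosided : ∀ a ∈ M, ∀ x : UniversalEnvelopingAlgebra F L, a * x ∈ M)
    (hproper : M ≠ ⊤)
    (hmax : ∀ J : Ideal (UniversalEnvelopingAlgebra F L),
      (∀ a ∈ J, ∀ x : UniversalEnvelopingAlgebra F L, a * x ∈ J) → M < J → J = ⊤) :
    Nontrivial (ExtGrp F (UniversalEnvelopingAlgebra F L)
      (ModuleCat.of (UniversalEnvelopingAlgebra F L) (UniversalEnvelopingAlgebra F L ⧸ M))
      (ModuleCat.of (UniversalEnvelopingAlgebra F L) (UniversalEnvelopingAlgebra F L))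
      (Module.finrank F L)) ∧
    ∀ n : ℕ, Module.finrank F L < n → Subsingleton (ExtGrp F (UniversalEnvelopingAlgebra F L)
      (ModuleCat.of (UniversalEnvelopingAlgebra F L) (UniversalEnvelopingAlgebra F L ⧸ M))
      (ModuleCat.of (UniversalEnvelopingAlgebra F L) (UniversalEnvelopingAlgebra F L))
      n) := by
  have : M.IsTwoSided := ⟨fun {a} x ha => htwosided a ha x⟩
  exact UGr.main_thm (Module.finBasis F L) p M hproper hmax
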